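/- For odd n ≥ 7, the directed Cayley graph of the alternating group A_n with generators τ_3, τ_5, …, τ_n has a directed Hamiltonian cycle. -/

import Mathlib

/-- `tau n k` is the permutation of positions `{1,…,n}` (0-indexed as `Fin n`) with
`τ_k(1)=k`, `τ_k(i)=i-1` for `2 ≤ i ≤ k`, and `τ_k(i)=i` for `i > k`. -/
def tau (n k : ℕ) : Equiv.Perm (Fin n) :=
  if h : k - 1 < n then (Fin.cycleRange ⟨k - 1, h⟩)⁻¹ else 1

/-- Reachability along `f` where steps are only taken from points outside `D`. -/
def Rch {α : Type*} (f : α → α) (D : Set α) : α → α → Prop :=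
  Relation.ReflTransGen (fun u v => u ∉ D ∧ v = f u)

/-- `f` maps `X` to itself and is strongly connected there. -/
def SC {α : Type*} (f : α → α) (X : Set α) : Prop :=
  (∀ a ∈ X, f a ∈ X) ∧ ∀ a ∈ X, ∀ b ∈ X, Rch f ∅ a b

theorem Rch.refl {α : Type*} (f : α → α) (D : Set α) (a : α) : Rch f D a a :=
  Relation.ReflTransGen.refl

theorem Rch.trans {α : Type*} {f : α → α} {D : Set α} {a b c : α}
    (h : Rch f D a b) (h' : Rch f D b c) : Rch f D a c :=
  Relation.ReflTransGen.trans h h'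

theorem Rch.single {α : Type*} {f : α → α} {D : Set α} {a : α} (h : a ∉ D) : Rch f D a (f a) :=
  Relation.ReflTransGen.single ⟨h, rfl⟩

theorem Rch.map {α β : Type*} {f : α → α} {f' : β → β} {D : Set α} {D' : Set β} (φ : α → β)
    (X : Set α) (hX : ∀ a ∈ X, f a ∈ X)
    (hs : ∀ u ∈ X, u ∉ D → φ u ∉ D' ∧ f' (φ u) = φ (f u)) {a b : α}
    (h : Rch f D a b) (ha : a ∈ X) : Rch f' D' (φ a) (φ b) := by
  suffices hh : b ∈ X ∧ Rch f' D' (φ a) (φ b) from hh.2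
  induction h with
  | refl => exact ⟨ha, Rch.refl _ _ _⟩
  | tail _ h2 ih =>
    obtain ⟨hu, rfl⟩ := h2
    refine ⟨hX _ ih.1, ih.2.trans ?_⟩
    obtain ⟨h3, h4⟩ := hs _ ih.1 hu
    rw [← h4]
    exact Rch.single h3

theorem Rch.anti {α : Type*} {f : α → α} {D D' : Set α} {a b : α} (hD : D' ⊆ D)
    (h : Rch f D a b) : Rch f D' a b :=
  Rch.map (f := f) id Set.univ (fun _ _ => trivial)
    (fun _ _ hu => ⟨fun h' => hu (hD h'), rfl⟩) h trivial

theorem first_hit {α : Type*} {f : α → α} (D : Set α) {a b : α} (h : Rch f ∅ a b) (hb : b ∈ D) :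
    ∃ d ∈ D, Rch f D a d := by
  induction h using Relation.ReflTransGen.head_induction_on with
  | refl => exact ⟨b, hb, Rch.refl _ _ _⟩
  | @head a c h1 _ ih =>
    by_cases ha : a ∈ D
    · exact ⟨a, ha, Rch.refl _ _ _⟩
    · obtain ⟨d, hd, hr⟩ := ih
      obtain ⟨_, rfl⟩ := h1
      exact ⟨d, hd, (Rch.single ha).trans hr⟩

theorem last_leave {α : Type*} {f : α → α} (D : Set α) {d0 b : α} (h : Rch f ∅ (f d0) b)
    (hd : d0 ∈ D) : ∃ d ∈ D, Rch f D (f d) b := by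
  induction h with
  | refl => exact ⟨d0, hd, Rch.refl _ _ _⟩
  | @tail b c _ h2 ih =>
    obtain ⟨_, rfl⟩ := h2
    by_cases hb : b ∈ D
    · exact ⟨b, hb, Rch.refl _ _ _⟩
    · obtain ⟨d, hd, hr⟩ := ih
      exact ⟨d, hd, hr.trans (Rch.single hb)⟩

theorem SC.single {α : Type*} {f : α → α} {X : Set α} (h : SC f X) {d a : α} (hd : d ∈ X)
    (ha : a ∈ X) : Rch f {d} a d ∧ Rch f {d} (f d) a := by
  constructor
  · obtain ⟨e, he, hr⟩ := first_hit {d} (h.2 a ha d hd) rfl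
    rw [Set.mem_singleton_iff] at he; subst he; exact hr
  · obtain ⟨e, he, hr⟩ := last_leave {d} (h.2 _ (h.1 d hd) a ha) rfl
    rw [Set.mem_singleton_iff] at he; subst he; exact hr

theorem ret_master {α ι : Type*} {f f' : α → α} (j : ι → α) (I : Set ι) (π r : ι → ι)
    (hoff : ∀ a, a ∉ j '' I → f' a = f a)
    (hπ : ∀ d ∈ I, π d ∈ I ∧ f' (j d) = f (j (π d)))
    (hr : ∀ d ∈ I, r d ∈ I ∧ Rch f (j '' I) (f (j d)) (j (r d)))
    (E : Set ι) (hE : E ⊆ I) (hj : Set.InjOn j I) {a b : ι} (ha : a ∈ I)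
    (h : Rch (r ∘ π) E a b) : b ∈ I ∧ Rch f' (j '' E) (j a) (j b) := by
  have conv : ∀ {u v}, Rch f (j '' I) u v → Rch f' (j '' I) u v := fun h =>
    Rch.map id Set.univ (fun _ _ => trivial) (fun u _ hu => ⟨hu, hoff u hu⟩) h trivial
  induction h with
  | refl => exact ⟨ha, Rch.refl _ _ _⟩
  | @tail b c _ h2 ih =>
    obtain ⟨hb, rfl⟩ := h2
    obtain ⟨ihb, ihr⟩ := ih
    refine ⟨(hr _ (hπ _ ihb).1).1, ihr.trans ?_⟩
    have h1 : j b ∉ j '' E := by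
      rintro ⟨e, he, hee⟩
      exact hb (hj (hE he) ihb hee ▸ he)
    refine (Rch.single h1).trans ?_
    rw [(hπ b ihb).2]
    exact (conv (hr _ (hπ _ ihb).1).2).anti (Set.image_mono hE)

theorem ret_start {α ι : Type*} {f f' : α → α} (j : ι → α) (I : Set ι) (π r : ι → ι)
    (hoff : ∀ a, a ∉ j '' I → f' a = f a)
    (hπ : ∀ d ∈ I, π d ∈ I ∧ f' (j d) = f (j (π d)))
    (hr : ∀ d ∈ I, r d ∈ I ∧ Rch f (j '' I) (f (j d)) (j (r d)))
    (E : Set ι) (hE : E ⊆ I) (hj : Set.InjOn j I) {a b : ι} (ha : a ∈ I)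
    (h : Rch (r ∘ π) E (r (π a)) b) : Rch f' (j '' E) (f' (j a)) (j b) := by
  have conv : ∀ {u v}, Rch f (j '' I) u v → Rch f' (j '' I) u v := fun h =>
    Rch.map id Set.univ (fun _ _ => trivial) (fun u _ hu => ⟨hu, hoff u hu⟩) h trivial
  rw [(hπ a ha).2]
  exact ((conv (hr _ (hπ _ ha).1).2).anti (Set.image_mono hE)).trans
    (ret_master j I π r hoff hπ hr E hE hj (hr _ (hπ _ ha).1).1 h).2

theorem SC_master {α ι : Type*} {f f' : α → α} (j : ι → α) (I : Set ι) (π r : ι → ι) (X : Set α)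
    (hDX : ∀ d ∈ I, j d ∈ X) (hX : ∀ a ∈ X, f a ∈ X)
    (hoff : ∀ a, a ∉ j '' I → f' a = f a)
    (hπ : ∀ d ∈ I, π d ∈ I ∧ f' (j d) = f (j (π d)))
    (hsurj : ∀ d ∈ I, ∃ d' ∈ I, π d' = d)
    (hr : ∀ d ∈ I, r d ∈ I ∧ Rch f (j '' I) (f (j d)) (j (r d)))
    (hj : Set.InjOn j I)
    (hc : ∀ d ∈ I, ∀ d' ∈ I, Rch (r ∘ π) ∅ d d')
    (hin : ∀ a ∈ X, ∃ d ∈ I, Rch f (j '' I) a (j d))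
    (hout : ∀ a ∈ X, ∃ d ∈ I, Rch f (j '' I) (f (j d)) a) : SC f' X := by
  have conv : ∀ {u v}, Rch f (j '' I) u v → Rch f' ∅ u v := fun h =>
    Rch.map id Set.univ (fun _ _ => trivial)
      (fun u _ hu => ⟨fun h => h.elim, hoff u hu⟩) h trivial
  constructor
  · intro a ha
    by_cases h : a ∈ j '' I
    · obtain ⟨d, hd, rfl⟩ := h
      rw [(hπ d hd).2]
      exact hX _ (hDX _ (hπ d hd).1)
    · rw [hoff a h]; exact hX a ha
  · intro a ha b hb
    obtain ⟨d, hd, h1⟩ := hin a ha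
    obtain ⟨e, he, h2⟩ := hout b hb
    obtain ⟨e', he', rfl⟩ := hsurj e he
    have h3 := (ret_master j I π r hoff hπ hr ∅ (Set.empty_subset _) hj hd (hc d hd e' he')).2
    rw [Set.image_empty] at h3
    refine (conv h1).trans (h3.trans ?_)
    refine (Rch.single (f := f') (D := ∅) (fun h => h.elim)).trans ?_
    rw [(hπ e' he').2]
    exact conv h2

/-- Cycles from an injective closed path. -/
theorem path_cycle {α : Type*} (p : ℕ → α) (L : ℕ) :
    ∀ (f : α → α), (∀ i < L, f (p i) = p (i + 1)) → ∀ (E : Set α) (i j : ℕ), i ≤ j → j ≤ L →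
      (∀ t, i ≤ t → t < j → p t ∉ E) → Rch f E (p i) (p j) := by
  intro f hf E i j hij
  induction j, hij using Nat.le_induction with
  | base => intro _ _; exact Rch.refl _ _ _
  | succ j hij ih =>
    intro hj h
    refine (ih (by omega) (fun t h1 h2 => h t h1 (by omega))).trans ?_
    rw [← hf j (by omega)]
    exact Rch.single (h j hij (by omega))

theorem path_SC {α : Type*} (p : ℕ → α) (L : ℕ) (hL : 0 < L)
    (hp : p L = p 0) (f : α → α) (hf : ∀ i < L, f (p i) = p (i + 1))
    (X : Set α) (hX : ∀ a, a ∈ X ↔ ∃ i < L, p i = a)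
    (hpath : ∀ (E : Set α) (i j : ℕ), i ≤ j → j ≤ L →
      (∀ t, i ≤ t → t < j → p t ∉ E) → Rch f E (p i) (p j)) : SC f X := by
  constructor
  · intro a ha
    obtain ⟨i, hi, rfl⟩ := (hX a).1 ha
    rw [hf i hi, hX]
    rcases Nat.lt_or_ge (i + 1) L with h | h
    · exact ⟨i + 1, h, rfl⟩
    · exact ⟨0, hL, by rw [← hp]; congr 1; omega⟩
  · intro a ha b hb
    obtain ⟨i, hi, rfl⟩ := (hX a).1 ha
    obtain ⟨j, hj, rfl⟩ := (hX b).1 hb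
    have h1 := hpath ∅ i L hi.le le_rfl (fun _ _ _ h => h)
    have h2 := hpath ∅ 0 j (Nat.zero_le _) hj.le (fun _ _ _ h => h)
    rw [hp] at h1
    exact h1.trans h2

theorem tau_zero {N k : ℕ} (_ : 1 ≤ k) (_ : k ≤ N) (i j : Fin N) (hi : i.val = 0)
    (hj : j.val = k - 1) : tau N k i = j := by
  have h : k - 1 < N := by omega
  have : NeZero N := ⟨by omega⟩
  rw [tau, dif_pos h, Equiv.Perm.inv_eq_iff_eq, Fin.cycleRange_of_eq (Fin.ext hj)]
  exact Fin.ext (by simpa using hi)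

theorem tau_mid {N k : ℕ} (hkN : k ≤ N) (i j : Fin N) (hi : 1 ≤ i.val) (hik : i.val < k)
    (hj : j.val = i.val - 1) : tau N k i = j := by
  have h : k - 1 < N := by omega
  have : NeZero N := ⟨by omega⟩
  rw [tau, dif_pos h, Equiv.Perm.inv_eq_iff_eq]
  apply Fin.ext
  rw [Fin.coe_cycleRange_of_lt (Fin.lt_def.2 (by simp only; omega))]
  omega

theorem tau_big {N k : ℕ} (hk : 1 ≤ k) (i : Fin N) (hik : k ≤ i.val) : tau N k i = i := by
  have h : k - 1 < N := by omega
  rw [tau, dif_pos h, Equiv.Perm.inv_eq_iff_eq, Fin.cycleRange_of_gt (Fin.lt_def.2 (by simp only; omega))]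

theorem sign_tau {N k : ℕ} (hk : Odd k) : Equiv.Perm.sign (tau N k) = 1 := by
  unfold tau
  split_ifs with h
  · rw [Equiv.Perm.sign_inv, Fin.sign_cycleRange]
    obtain ⟨c, rfl⟩ := hk
    exact Even.neg_one_pow ⟨c, by simp only; omega⟩
  · simp

/-- Even permutations moving only the first `m` positions. -/
def AA (N m : ℕ) : Subgroup (Equiv.Perm (Fin N)) where
  carrier := {g | Equiv.Perm.sign g = 1 ∧ ∀ i : Fin N, m ≤ i.val → g i = i}
  one_mem' := by simp
  mul_mem' := by
    rintro a b ⟨h1, h2⟩ ⟨h3, h4⟩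
    refine ⟨by rw [Equiv.Perm.sign_mul, h1, h3, one_mul], fun i hi => ?_⟩
    rw [Equiv.Perm.mul_apply, h4 i hi, h2 i hi]
  inv_mem' := by
    rintro a ⟨h1, h2⟩
    refine ⟨by rw [Equiv.Perm.sign_inv, h1], fun i hi => ?_⟩
    rw [Equiv.Perm.inv_eq_iff_eq, h2 i hi]

theorem mem_AA {N m : ℕ} {g : Equiv.Perm (Fin N)} :
    g ∈ AA N m ↔ Equiv.Perm.sign g = 1 ∧ ∀ i : Fin N, m ≤ i.val → g i = i := Iff.rfl

theorem AA_mono {N m n : ℕ} (h : m ≤ n) {g : Equiv.Perm (Fin N)} (hg : g ∈ AA N m) : g ∈ AA N n :=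
  ⟨hg.1, fun i hi => hg.2 i (h.trans hi)⟩

theorem tau_mem {N k m : ℕ} (hk : Odd k) (hkm : k ≤ m) : tau N k ∈ AA N m :=
  ⟨sign_tau hk, fun i hi => tau_big hk.pos i (hkm.trans hi)⟩

theorem AA_lt {N m : ℕ} {g : Equiv.Perm (Fin N)} (hg : g ∈ AA N m) {i : Fin N} (hi : i.val < m) :
    (g i).val < m := by
  by_contra h
  have h1 := hg.2 (g i) (by omega)
  have h2 := g.injective h1
  rw [h2] at h; omega

/-- The rotation of the last three among the first `n` positions. -/
def xx (N n : ℕ) : Equiv.Perm (Fin N) := tau N n * (tau N (n - 2))⁻¹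

theorem xx_mul_tau (N n : ℕ) : xx N n * tau N (n - 2) = tau N n := by
  rw [xx, inv_mul_cancel_right]

theorem xx_inv_mul_tau (N n : ℕ) : (xx N n)⁻¹ * tau N n = tau N (n - 2) := by
  rw [inv_mul_eq_iff_eq_mul, xx_mul_tau]

theorem xx_mem {N n : ℕ} (hn : Odd n) (h3 : 3 ≤ n) : xx N n ∈ AA N n := by
  refine mul_mem (tau_mem hn le_rfl) (inv_mem (tau_mem ?_ (Nat.sub_le _ _)))
  obtain ⟨c, rfl⟩ := hn
  exact ⟨c - 1, by omega⟩

theorem xx_apply {N n : ℕ} (h3 : 3 ≤ n) (hN : n ≤ N) {P Q R : Fin N} (hP : P.val = n - 3)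
    (hQ : Q.val = n - 2) (hR : R.val = n - 1) :
    xx N n P = R ∧ xx N n Q = P ∧ xx N n R = Q ∧
      ∀ i, i ≠ P → i ≠ Q → i ≠ R → xx N n i = i := by
  have key : ∀ i j : Fin N, tau N (n - 2) j = i → xx N n i = tau N n j := by
    rintro i j rfl
    simp [xx]
  refine ⟨?_, ?_, ?_, ?_⟩
  · rw [key P ⟨0, by omega⟩ (tau_zero (by omega) (by omega) _ _ rfl (by omega))]
    exact tau_zero (by omega) hN _ _ rfl hR
  · rw [key Q Q (tau_big (by omega) _ (by omega))]
    exact tau_mid hN _ _ (by omega) (by omega) (by omega)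
  · rw [key R R (tau_big (by omega) _ (by omega))]
    exact tau_mid hN _ _ (by omega) (by omega) (by omega)
  · intro i h1 h2 h3'
    have h1 : i.val ≠ n - 3 := fun h => h1 (Fin.ext (h.trans hP.symm))
    have h2 : i.val ≠ n - 2 := fun h => h2 (Fin.ext (h.trans hQ.symm))
    have h4 : i.val ≠ n - 1 := fun h => h3' (Fin.ext (h.trans hR.symm))
    rcases Nat.lt_or_ge i.val (n - 3) with h | h
    · rw [key i ⟨i.val + 1, by omega⟩ (tau_mid (by omega) _ _ (by simp) (by simp only; omega) (by simp))]
      exact tau_mid hN _ _ (by simp) (by simp only; omega) (by simp)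
    · rw [key i i (tau_big (by omega) _ (by omega))]
      exact tau_big (by omega) _ (by omega)

theorem xx_cube {N n : ℕ} (h3 : 3 ≤ n) (hN : n ≤ N) : xx N n * xx N n * xx N n = 1 := by
  obtain ⟨h1, h2, h3, h4⟩ := xx_apply (N := N) (n := n) h3 hN (P := ⟨n - 3, by omega⟩)
    (Q := ⟨n - 2, by omega⟩) (R := ⟨n - 1, by omega⟩) rfl rfl rfl
  ext i
  simp only [Equiv.Perm.mul_apply, Equiv.Perm.one_apply]
  by_cases hP : i = ⟨n - 3, by omega⟩
  · rw [hP, h1, h3, h2]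
  by_cases hQ : i = ⟨n - 2, by omega⟩
  · rw [hQ, h2, h1, h3]
  by_cases hR : i = ⟨n - 1, by omega⟩
  · rw [hR, h3, h2, h1]
  · rw [h4 i hP hQ hR, h4 i hP hQ hR, h4 i hP hQ hR]

/-- The three powers of `xx`. -/
def EE (N n : ℕ) : Set (Equiv.Perm (Fin N)) := {e | e = 1 ∨ e = xx N n ∨ e = xx N n * xx N n}

theorem EE_sub {N n : ℕ} (hn : Odd n) (h3 : 3 ≤ n) {e : Equiv.Perm (Fin N)} (he : e ∈ EE N n) :
    e ∈ AA N n := by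
  have := xx_mem (N := N) hn h3
  rcases he with rfl | rfl | rfl
  · exact one_mem _
  · exact this
  · exact mul_mem this this

theorem coset_iff {N m : ℕ} (_ : m + 2 ≤ N) {Q R : Fin N} (hQ : Q.val = m) (hR : R.val = m + 1)
    {g : Equiv.Perm (Fin N)} (hg : g ∈ AA N (m + 2)) (h : Equiv.Perm (Fin N)) :
    g⁻¹ * h ∈ AA N m ↔ h ∈ AA N (m + 2) ∧ h Q = g Q ∧ h R = g R := by
  constructor
  · intro hh
    refine ⟨?_, ?_, ?_⟩
    · have := mul_mem hg (AA_mono (show m ≤ m + 2 by omega) hh)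
      simpa using this
    · have := hh.2 Q (by omega)
      rwa [Equiv.Perm.mul_apply, Equiv.Perm.inv_eq_iff_eq] at this
    · have := hh.2 R (by omega)
      rwa [Equiv.Perm.mul_apply, Equiv.Perm.inv_eq_iff_eq] at this
  · rintro ⟨h1, h2, h3⟩
    have h4 := mul_mem (inv_mem hg) h1
    refine ⟨h4.1, fun i hi => ?_⟩
    by_cases e1 : i.val = m
    · have : i = Q := Fin.ext (by omega)
      rw [this, Equiv.Perm.mul_apply, h2, Equiv.Perm.inv_eq_iff_eq]
    by_cases e2 : i.val = m + 1
    · have : i = R := Fin.ext (by omega)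
      rw [this, Equiv.Perm.mul_apply, h3, Equiv.Perm.inv_eq_iff_eq]
    · exact h4.2 i (by omega)

/-- The inductive invariant. -/
structure Ham (N m : ℕ) (f : Equiv.Perm (Fin N) → Equiv.Perm (Fin N)) : Prop where
  sc : SC f (AA N m : Set (Equiv.Perm (Fin N)))
  edge : ∀ g ∈ AA N m, ∃ k, Odd k ∧ 3 ≤ k ∧ k ≤ m ∧ f g = g * tau N k
  last : ∀ v P : Fin N, v.val < m → P.val = m - 1 → ∃ g ∈ AA N m, g P = v ∧ f g = g * tau N m
  trip : ∀ e ∈ EE N m, f e = e * tau N m ∧ Rch f (EE N m) (f e) (e * (xx N m)⁻¹)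

/-- Partial union of cosets. -/
def XX (N n : ℕ) (Q R : Fin N) (K : Set (Fin N × Fin N)) : Set (Equiv.Perm (Fin N)) :=
  {g | g ∈ AA N n ∧ (g Q, g R) ∈ K}

/-- The partial invariant. -/
structure Good (N m : ℕ) (P Q R : Fin N) (K : Set (Fin N × Fin N))
    (f : Equiv.Perm (Fin N) → Equiv.Perm (Fin N)) : Prop where
  sc : SC f (XX N (m + 2) Q R K)
  edge : ∀ g ∈ XX N (m + 2) Q R K, ∃ k, Odd k ∧ 3 ≤ k ∧ k ≤ m + 2 ∧ f g = g * tau N k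
  free : ∀ a b c : Fin N, (b, c) ∈ K → a ≠ b → a ≠ c → a.val < m + 2 → (a, b) ∉ K → (c, a) ∉ K →
    ∃ g ∈ XX N (m + 2) Q R K, g P = a ∧ g Q = b ∧ g R = c ∧ f g = g * tau N m
  last : ∀ p q : Fin N, (p, q) ∈ K → ∃ g ∈ XX N (m + 2) Q R K, g R = q ∧ f g = g * tau N (m + 2)
  sub : ∀ e ∈ EE N (m + 2), e ∈ XX N (m + 2) Q R K
  trip : ∀ e ∈ EE N (m + 2), f e = e * tau N (m + 2) ∧
    Rch f (EE N (m + 2)) (f e) (e * (xx N (m + 2))⁻¹)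

theorem growth {N m : ℕ} (hm : Odd m) (h3 : 3 ≤ m) (hN : m + 2 ≤ N) {P Q R : Fin N}
    (hP : P.val = m - 1) (hQ : Q.val = m) (hR : R.val = m + 1)
    {S : Equiv.Perm (Fin N) → Equiv.Perm (Fin N)} (hS : Ham N m S)
    {K : Set (Fin N × Fin N)} {f : Equiv.Perm (Fin N) → Equiv.Perm (Fin N)}
    (hf : Good N m P Q R K f) {a b c : Fin N} (hbc : (b, c) ∈ K) (hab : a ≠ b) (hac : a ≠ c)
    (han : a.val < m + 2) (habK : (a, b) ∉ K) (hcaK : (c, a) ∉ K) :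
    ∃ f', Good N m P Q R (K ∪ {(a, b), (c, a)}) f' := by
  classical
  have hn : Odd (m + 2) := by obtain ⟨t, rfl⟩ := hm; exact ⟨t + 1, by ring⟩
  obtain ⟨g, hgX, hgP, hgQ, hgR, hfg⟩ := hf.free a b c hbc hab hac han habK hcaK
  obtain ⟨xP, xQ, xR, -⟩ := xx_apply (N := N) (n := m + 2) (by omega) hN (P := P) (Q := Q) (R := R)
    (by omega) (by omega) (by omega)
  have hx := xx_mem (N := N) hn (by omega)
  have hcube := xx_cube (N := N) (n := m + 2) (by omega) hN
  have hxt := xx_mul_tau N (m + 2)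
  rw [Nat.add_sub_cancel] at hxt
  set x := xx N (m + 2) with hxdef
  have hbc' : b ≠ c := by
    rw [← hgQ, ← hgR]; intro h
    have := congrArg Fin.val (g.injective h); omega
  have hg : g ∈ AA N (m + 2) := hgX.1
  obtain ⟨g1, hg1⟩ : ∃ g1, g1 = g * x := ⟨_, rfl⟩
  obtain ⟨g2, hg2⟩ : ∃ g2, g2 = g * x * x := ⟨_, rfl⟩
  have hg1A : g1 ∈ AA N (m + 2) := hg1 ▸ mul_mem hg hx
  have hg2A : g2 ∈ AA N (m + 2) := hg2 ▸ mul_mem (mul_mem hg hx) hx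
  have g1P : g1 P = c := by rw [hg1, Equiv.Perm.mul_apply, xP, hgR]
  have g1Q : g1 Q = a := by rw [hg1, Equiv.Perm.mul_apply, xQ, hgP]
  have g1R : g1 R = b := by rw [hg1, Equiv.Perm.mul_apply, xR, hgQ]
  have g2P : g2 P = b := by rw [hg2, ← hg1, Equiv.Perm.mul_apply, xP, g1R]
  have g2Q : g2 Q = c := by rw [hg2, ← hg1, Equiv.Perm.mul_apply, xQ, g1P]
  have g2R : g2 R = a := by rw [hg2, ← hg1, Equiv.Perm.mul_apply, xR, g1Q]
  have c1 := coset_iff hN hQ hR hg1A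
  have c2 := coset_iff hN hQ hR hg2A
  rw [g1Q, g1R] at c1
  rw [g2Q, g2R] at c2
  set X := XX N (m + 2) Q R K with hXdef
  set f0 : Equiv.Perm (Fin N) → Equiv.Perm (Fin N) := fun h =>
    if h ∈ X then f h else if g1⁻¹ * h ∈ AA N m then g1 * S (g1⁻¹ * h) else g2 * S (g2⁻¹ * h)
    with hf0
  set D : Set (Equiv.Perm (Fin N)) := {g, g1, g2} with hD
  set f' : Equiv.Perm (Fin N) → Equiv.Perm (Fin N) := fun h =>
    if h ∈ D then h * tau N (m + 2) else f0 h with hf'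
  have n1 : ∀ u ∈ AA N m, g1 * u ∉ X := by
    intro u hu h
    have := (c1 (g1 * u)).1 (by simpa using hu)
    have h2 := h.2
    rw [this.2.1, this.2.2] at h2; exact habK h2
  have n2 : ∀ u ∈ AA N m, g2 * u ∉ X := by
    intro u hu h
    have := (c2 (g2 * u)).1 (by simpa using hu)
    have h2 := h.2
    rw [this.2.1, this.2.2] at h2; exact hcaK h2
  have n12 : ∀ u ∈ AA N m, g1⁻¹ * (g2 * u) ∉ AA N m := by
    intro u hu h
    have h1 := (c1 _).1 h
    have h2 := (c2 (g2 * u)).1 (by simpa using hu)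
    rw [h2.2.1] at h1; exact hac h1.2.1.symm
  have f0X : ∀ u ∈ X, f0 u = f u := fun u hu => by rw [hf0]; simp only [if_pos hu]
  have f01 : ∀ u ∈ AA N m, f0 (g1 * u) = g1 * S u := fun u hu => by
    simp only [hf0, if_neg (n1 u hu), inv_mul_cancel_left, if_pos hu]
  have f02 : ∀ u ∈ AA N m, f0 (g2 * u) = g2 * S u := fun u hu => by
    simp only [hf0, if_neg (n2 u hu), if_neg (n12 u hu), inv_mul_cancel_left]
  have one_m : (1 : Equiv.Perm (Fin N)) ∈ AA N m := one_mem _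
  have g1X : g1 ∉ X := by simpa using n1 1 one_m
  have g2X : g2 ∉ X := by simpa using n2 1 one_m
  have g1g2 : g1 ≠ g2 := by intro h; rw [h, g2Q] at g1Q; exact hac g1Q.symm
  have hS1 : S 1 = tau N m := by simpa using (hS.trip 1 (Or.inl rfl)).1
  have f0g : f0 g = g * tau N m := by rw [f0X g hgX, hfg]
  have f0g1 : f0 g1 = g1 * tau N m := by simpa [hS1] using f01 1 one_m
  have f0g2 : f0 g2 = g2 * tau N m := by simpa [hS1] using f02 1 one_m
  -- paths
  set W : Set (Equiv.Perm (Fin N)) := X ∪ {g1, g2} with hW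
  have DW : D ⊆ W := by
    rintro u (rfl | rfl | rfl)
    · exact Or.inl hgX
    · exact Or.inr (Or.inl rfl)
    · exact Or.inr (Or.inr rfl)
  have p0 : ∀ {u v}, u ∈ X → Rch f {g} u v → Rch f0 D u v := by
    intro u v hu h
    refine Rch.map id X hf.sc.1 (fun w hw hwg => ⟨?_, f0X w hw⟩) h hu
    rintro (rfl | rfl | rfl)
    · exact hwg rfl
    · exact g1X hw
    · exact g2X hw
  have p1 : ∀ {u v}, u ∈ AA N m → Rch S {1} u v → Rch f0 W (g1 * u) (g1 * v) := by
    intro u v hu h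
    refine Rch.map (fun z => g1 * z) (AA N m) hS.sc.1 (fun w hw hwg => ⟨?_, f01 w hw⟩) h hu
    rintro (h | h | h)
    · exact n1 w hw h
    · exact hwg (by simpa using h)
    · have h : g1 * w = g2 := h
      apply n12 1 one_m
      rw [mul_one, ← h, inv_mul_cancel_left]; exact hw
  have p2 : ∀ {u v}, u ∈ AA N m → Rch S {1} u v → Rch f0 W (g2 * u) (g2 * v) := by
    intro u v hu h
    refine Rch.map (fun z => g2 * z) (AA N m) hS.sc.1 (fun w hw hwg => ⟨?_, f02 w hw⟩) h hu
    rintro (h | h | h)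
    · exact n2 w hw h
    · have h : g2 * w = g1 := h
      apply n12 w hw
      rw [h, inv_mul_cancel]; exact one_m
    · exact hwg (by simpa using h)
  have hS1A : S 1 ∈ AA N m := hS.sc.1 1 one_m
  have q1 : Rch f0 W (f0 g1) g1 := by
    have := p1 hS1A (hS.sc.single one_m hS1A).1
    rwa [mul_one, hS1, ← f0g1] at this
  have q2 : Rch f0 W (f0 g2) g2 := by
    have := p2 hS1A (hS.sc.single one_m hS1A).1
    rwa [mul_one, hS1, ← f0g2] at this
  have fD : ∀ h ∈ D, f' h = h * tau N (m + 2) := fun h hh => by simp only [hf', if_pos hh]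
  have f'g : f' g = f0 g1 := by
    rw [fD g (Or.inl rfl), f0g1, hg1, mul_assoc, hxt]
  have f'g1 : f' g1 = f0 g2 := by
    rw [fD g1 (Or.inr (Or.inl rfl)), f0g2, hg2, hg1, mul_assoc (g * x), hxt]
  have f'g2 : f' g2 = f0 g := by
    rw [fD g2 (Or.inr (Or.inr rfl)), f0g, hg2, ← hxt, ← mul_assoc, mul_assoc g, mul_assoc g, hcube,
      mul_one]
  have hoff : ∀ u, u ∉ D → f' u = f0 u := fun u hu => by simp only [hf', if_neg hu]
  have XK' : ∀ h, h ∈ XX N (m + 2) Q R (K ∪ {(a, b), (c, a)}) ↔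
      h ∈ X ∨ g1⁻¹ * h ∈ AA N m ∨ g2⁻¹ * h ∈ AA N m := by
    intro h
    rw [c1, c2]
    simp only [hXdef, XX, Set.mem_ofPred_eq, Set.mem_union, Set.mem_insert_iff,
      Set.mem_singleton_iff, Prod.mk.injEq]
    tauto
  have sX : ∀ h ∈ X, h ∈ XX N (m + 2) Q R (K ∪ {(a, b), (c, a)}) := fun h hh => (XK' h).2 (Or.inl hh)
  have s1 : ∀ u ∈ AA N m, g1 * u ∈ XX N (m + 2) Q R (K ∪ {(a, b), (c, a)}) := fun u hu =>
    (XK' _).2 (Or.inr (Or.inl (by simpa using hu)))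
  have s2 : ∀ u ∈ AA N m, g2 * u ∈ XX N (m + 2) Q R (K ∪ {(a, b), (c, a)}) := fun u hu =>
    (XK' _).2 (Or.inr (Or.inr (by simpa using hu)))
  have s1' : g1 ∈ XX N (m + 2) Q R (K ∪ {(a, b), (c, a)}) := by simpa using s1 1 one_m
  have s2' : g2 ∈ XX N (m + 2) Q R (K ∪ {(a, b), (c, a)}) := by simpa using s2 1 one_m
  have cases' : ∀ h ∈ XX N (m + 2) Q R (K ∪ {(a, b), (c, a)}), h ∈ X ∨
      (∃ u ∈ AA N m, h = g1 * u) ∨ (∃ u ∈ AA N m, h = g2 * u) := by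
    intro h hh
    rcases (XK' h).1 hh with h1 | h1 | h1
    · exact Or.inl h1
    · exact Or.inr (Or.inl ⟨_, h1, by simp⟩)
    · exact Or.inr (Or.inr ⟨_, h1, by simp⟩)
  have hgE : g ∉ EE N (m + 2) := by
    intro h
    have := (hf.trip g h).1
    rw [hfg] at this
    have h2 : tau N m R = tau N (m + 2) R := by rw [mul_left_cancel this]
    rw [tau_big (by omega) R (by omega), tau_mid hN R Q (by omega) (by omega) (by omega)] at h2
    have := congrArg Fin.val h2; omega
  have WE : EE N (m + 2) ⊆ W := fun e he => Or.inl (hf.sub e he)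
  have conv : ∀ {u v}, Rch f0 W u v → Rch f' (EE N (m + 2)) u v := fun h =>
    Rch.map id Set.univ (fun _ _ => trivial)
      (fun u _ hu => ⟨fun h => hu (WE h), hoff u (fun h => hu (DW h))⟩) h trivial
  have stepf : ∀ u ∈ X, Rch f' (EE N (m + 2)) (f' u) (f u) := by
    intro u hu
    by_cases hug : u = g
    · rw [hug, f'g]
      have e1 : g1 ∉ EE N (m + 2) := fun h => g1X (hf.sub _ h)
      have e2 : g2 ∉ EE N (m + 2) := fun h => g2X (hf.sub _ h)
      have t1 : Rch f' (EE N (m + 2)) g1 (f' g1) := Rch.single e1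
      have t2 : Rch f' (EE N (m + 2)) g2 (f' g2) := Rch.single e2
      rw [f'g1] at t1
      rw [f'g2, f0X g hgX] at t2
      exact (conv q1).trans (t1.trans ((conv q2).trans t2))
    · have : u ∉ D := by
        rintro (h | h | h)
        · exact hug h
        · exact g1X (h ▸ hu)
        · have h : u = g2 := h
          exact g2X (h ▸ hu)
      rw [hoff u this, f0X u hu]; exact Rch.refl _ _ _
  have convE : ∀ {u v}, u ∈ X → Rch f (EE N (m + 2)) u v → Rch f' (EE N (m + 2)) u v := by
    intro u v hu h
    suffices hh : v ∈ X ∧ Rch f' (EE N (m + 2)) u v from hh.2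
    induction h with
    | refl => exact ⟨hu, Rch.refl _ _ _⟩
    | tail _ h2 ih =>
      obtain ⟨hw, rfl⟩ := h2
      exact ⟨hf.sc.1 _ ih.1, ih.2.trans ((Rch.single hw).trans (stepf _ ih.1))⟩
  refine ⟨f', ?_, ?_, ?_, ?_, ?_, ?_⟩
  · -- sc
    have hDim : (id : Equiv.Perm (Fin N) → Equiv.Perm (Fin N)) '' D = D := Set.image_id D
    have gD : g ∈ D := Or.inl rfl
    have g1D : g1 ∈ D := Or.inr (Or.inl rfl)
    have g2D : g2 ∈ D := Or.inr (Or.inr rfl)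
    have x1 : g * x = g1 := hg1.symm
    have x2 : g1 * x = g2 := by rw [hg1, hg2]
    have x3 : g2 * x = g := by rw [hg2, mul_assoc g, mul_assoc g, hcube, mul_one]
    have e0 : Rch ((id : Equiv.Perm (Fin N) → _) ∘ fun z => z * x) ∅ g g1 := by
      rw [← x1]; exact Rch.single (f := id ∘ fun z => z * x) (fun h => h.elim)
    have e1 : Rch ((id : Equiv.Perm (Fin N) → _) ∘ fun z => z * x) ∅ g1 g2 := by
      rw [← x2]; exact Rch.single (f := id ∘ fun z => z * x) (fun h => h.elim)
    have e2 : Rch ((id : Equiv.Perm (Fin N) → _) ∘ fun z => z * x) ∅ g2 g := by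
      conv => rhs; rw [← x3]
      exact Rch.single (f := id ∘ fun z => z * x) (fun h => h.elim)
    refine SC_master (f := f0) id D (fun z => z * x) id _ ?_ ?_ ?_ ?_ ?_ ?_ (Set.injOn_id _) ?_ ?_ ?_
    · rintro d (rfl | rfl | rfl)
      · exact sX _ hgX
      · exact s1'
      · exact s2'
    · intro h hh
      rcases cases' h hh with h1 | ⟨u, hu, rfl⟩ | ⟨u, hu, rfl⟩
      · rw [f0X h h1]; exact sX _ (hf.sc.1 h h1)
      · rw [f01 u hu]; exact s1 _ (hS.sc.1 u hu)
      · rw [f02 u hu]; exact s2 _ (hS.sc.1 u hu)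
    · rw [hDim]; exact hoff
    · rintro d (h | h | h)
      · rw [h]; simp only [x1, id]; exact ⟨g1D, f'g⟩
      · rw [h]; simp only [x2, id]; exact ⟨g2D, f'g1⟩
      · have h : d = g2 := h
        rw [h]; simp only [x3, id]; exact ⟨gD, f'g2⟩
    · rintro d (h | h | h)
      · exact ⟨g2, g2D, by rw [h]; exact x3⟩
      · exact ⟨g, gD, by rw [h]; exact x1⟩
      · have h : d = g2 := h
        exact ⟨g1, g1D, by rw [h]; exact x2⟩
    · rw [hDim]
      rintro d (h | h | h)
      · rw [h]; refine ⟨gD, ?_⟩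
        simp only [id]; rw [f0X g hgX]
        exact p0 (hf.sc.1 g hgX) (hf.sc.single hgX (hf.sc.1 g hgX)).1
      · rw [h]; exact ⟨g1D, q1.anti DW⟩
      · have h : d = g2 := h
        rw [h]; exact ⟨g2D, q2.anti DW⟩
    · rintro d (h | h | h) d' (h' | h' | h') <;> (first | rw [h] | rw [Set.mem_singleton_iff.1 h]) <;>
        (first | rw [h'] | rw [Set.mem_singleton_iff.1 h'])
      · exact Rch.refl _ _ _
      · exact e0
      · exact e0.trans e1
      · exact e1.trans e2
      · exact Rch.refl _ _ _
      · exact e1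
      · exact e2
      · exact e2.trans e0
      · exact Rch.refl _ _ _
    · rw [hDim]
      intro h hh
      rcases cases' h hh with h1 | ⟨u, hu, rfl⟩ | ⟨u, hu, rfl⟩
      · exact ⟨g, gD, p0 h1 (hf.sc.single hgX h1).1⟩
      · refine ⟨g1, g1D, ?_⟩
        have := (p1 hu (hS.sc.single one_m hu).1).anti DW
        rwa [mul_one] at this
      · refine ⟨g2, g2D, ?_⟩
        have := (p2 hu (hS.sc.single one_m hu).1).anti DW
        rwa [mul_one] at this
    · rw [hDim]
      intro h hh
      rcases cases' h hh with h1 | ⟨u, hu, rfl⟩ | ⟨u, hu, rfl⟩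
      · refine ⟨g, gD, ?_⟩
        simp only [id]; rw [f0X g hgX]
        exact p0 (hf.sc.1 g hgX) (hf.sc.single hgX h1).2
      · refine ⟨g1, g1D, ?_⟩
        have := (p1 hS1A (hS.sc.single one_m hu).2).anti DW
        rwa [hS1, ← f0g1] at this
      · refine ⟨g2, g2D, ?_⟩
        have := (p2 hS1A (hS.sc.single one_m hu).2).anti DW
        rwa [hS1, ← f0g2] at this
  · -- edge
    intro h hh
    by_cases hhD : h ∈ D
    · exact ⟨m + 2, hn, by omega, le_rfl, by simp only [hf', if_pos hhD]⟩
    · rw [hoff h hhD]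
      rcases cases' h hh with h1 | ⟨u, hu, rfl⟩ | ⟨u, hu, rfl⟩
      · rw [f0X h h1]; exact hf.edge h h1
      · obtain ⟨k, k1, k2, k3, k4⟩ := hS.edge u hu
        exact ⟨k, k1, k2, by omega, by rw [f01 u hu, k4, mul_assoc]⟩
      · obtain ⟨k, k1, k2, k3, k4⟩ := hS.edge u hu
        exact ⟨k, k1, k2, by omega, by rw [f02 u hu, k4, mul_assoc]⟩
  · -- free
    intro a' b' c' hK' hab' hac' han' h1 h2
    have h1K : (a', b') ∉ K := fun h => h1 (Or.inl h)
    have h2K : (c', a') ∉ K := fun h => h2 (Or.inl h)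
    have key : ∀ gi, gi ∈ AA N (m + 2) → gi Q = b' → gi R = c' → (∀ u ∈ AA N m, f0 (gi * u) = gi * S u) →
        (∀ u ∈ AA N m, gi * u ∈ XX N (m + 2) Q R (K ∪ {(a, b), (c, a)})) →
        (∀ h, h Q = b' → h R = c' → h ∈ D → h P ≠ a') →
        ∃ g ∈ XX N (m + 2) Q R (K ∪ {(a, b), (c, a)}),
          g P = a' ∧ g Q = b' ∧ g R = c' ∧ f' g = g * tau N m := by
      intro gi hgi hiQ hiR hi1 hi2 hi3
      have hgi' := inv_mem hgi
      have hlt := AA_lt hgi' han'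
      have hv : (gi⁻¹ a').val < m := by
        by_contra hlt'
        rcases (show (gi⁻¹ a').val = m ∨ (gi⁻¹ a').val = m + 1 by omega) with h | h
        · have : gi⁻¹ a' = Q := Fin.ext (by omega)
          rw [Equiv.Perm.inv_eq_iff_eq, hiQ] at this; exact hab' this
        · have : gi⁻¹ a' = R := Fin.ext (by omega)
          rw [Equiv.Perm.inv_eq_iff_eq, hiR] at this; exact hac' this
      obtain ⟨u, hu, hu1, hu2⟩ := hS.last (gi⁻¹ a') P hv hP
      have e1 : (gi * u) P = a' := by rw [Equiv.Perm.mul_apply, hu1]; simp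
      have e2 : (gi * u) Q = b' := by rw [Equiv.Perm.mul_apply, hu.2 Q (by omega), hiQ]
      have e3 : (gi * u) R = c' := by rw [Equiv.Perm.mul_apply, hu.2 R (by omega), hiR]
      refine ⟨gi * u, hi2 u hu, e1, e2, e3, ?_⟩
      rw [hoff _ (fun h => hi3 _ e2 e3 h e1), hi1 u hu, hu2, mul_assoc]
    rcases hK' with hK' | hK' | hK'
    · obtain ⟨h, hh, hhP, hhQ, hhR, hfh⟩ := hf.free a' b' c' hK' hab' hac' han' h1K h2K
      refine ⟨h, sX h hh, hhP, hhQ, hhR, ?_⟩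
      have : h ∉ D := by
        rintro (e | e | e)
        · rw [e, hgP] at hhP; rw [e, hgQ] at hhQ
          subst hhP; subst hhQ
          exact h1 (Or.inr (Or.inl rfl))
        · exact g1X (e ▸ hh)
        · have e : h = g2 := e
          exact g2X (e ▸ hh)
      rw [hoff h this, f0X h hh, hfh]
    · rw [Prod.mk.injEq] at hK'
      obtain ⟨rfl, rfl⟩ := hK'
      refine key g1 hg1A g1Q g1R f01 s1 ?_
      rintro h q1 q2 (e | e | e) q3
      · rw [e, hgQ] at q1; exact hab q1.symm
      · rw [e, g1P] at q3; rw [← q3] at h1; exact h1 (Or.inr (Or.inr rfl))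
      · have e : h = g2 := e
        rw [e, g2Q] at q1; exact hac q1.symm
    · have hK' : (b', c') = (c, a) := hK'
      rw [Prod.mk.injEq] at hK'
      obtain ⟨rfl, rfl⟩ := hK'
      refine key g2 hg2A g2Q g2R f02 s2 ?_
      rintro h q1 q2 (e | e | e) q3
      · rw [e, hgQ] at q1; exact hbc' q1
      · rw [e, g1Q] at q1; exact hac q1
      · have e : h = g2 := e
        rw [e, g2P] at q3; rw [← q3] at h1; exact h1 (Or.inl hbc)
  · -- last
    intro p q hpq
    rcases hpq with h | h | h
    · obtain ⟨h, hh, hhR, hfh⟩ := hf.last p q h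
      by_cases hD' : h ∈ D
      · exact ⟨h, sX h hh, hhR, fD h hD'⟩
      · exact ⟨h, sX h hh, hhR, by rw [hoff h hD', f0X h hh, hfh]⟩
    · rw [Prod.mk.injEq] at h
      exact ⟨g1, s1', by rw [g1R, h.2], fD _ (Or.inr (Or.inl rfl))⟩
    · have h : (p, q) = (c, a) := h
      rw [Prod.mk.injEq] at h
      exact ⟨g2, s2', by rw [g2R, h.2], fD _ (Or.inr (Or.inr rfl))⟩
  · intro e he; exact sX e (hf.sub e he)
  · intro e he
    have heX := hf.sub e he
    have heD : e ∉ D := by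
      rintro (h | h | h)
      · exact hgE (h ▸ he)
      · exact g1X (h ▸ heX)
      · have h : e = g2 := h
        exact g2X (h ▸ heX)
    refine ⟨by rw [hoff e heD, f0X e heX, (hf.trip e he).1], ?_⟩
    exact (stepf e heX).trans (convE (hf.sc.1 e heX) (hf.trip e he).2)

/-- All ordered pairs of distinct values in `[j, n)`. -/
def KK (N n j : ℕ) : Set (Fin N × Fin N) :=
  {z | z.1.val ≠ z.2.val ∧ j ≤ z.1.val ∧ j ≤ z.2.val ∧ z.1.val < n ∧ z.2.val < n}

/-- Intermediate sets of pairs. -/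
def KI (N n v t : ℕ) : Set (Fin N × Fin N) :=
  {z | (z.1.val ≠ z.2.val ∧ v + 1 ≤ z.1.val ∧ v + 1 ≤ z.2.val ∧ z.1.val < n ∧ z.2.val < n) ∨
    (z.1.val = v ∧ v + 1 ≤ z.2.val ∧ z.2.val < v + 1 + t) ∨
    (z.2.val = v ∧ v + 1 < z.1.val ∧ z.1.val ≤ v + 1 + t)}

theorem mem_KK {N n j : ℕ} (p q : Fin N) : (p, q) ∈ KK N n j ↔
    p.val ≠ q.val ∧ j ≤ p.val ∧ j ≤ q.val ∧ p.val < n ∧ q.val < n := Iff.rfl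

theorem mem_KI {N n v t : ℕ} (p q : Fin N) : (p, q) ∈ KI N n v t ↔
    (p.val ≠ q.val ∧ v + 1 ≤ p.val ∧ v + 1 ≤ q.val ∧ p.val < n ∧ q.val < n) ∨
    (p.val = v ∧ v + 1 ≤ q.val ∧ q.val < v + 1 + t) ∨
    (q.val = v ∧ v + 1 < p.val ∧ p.val ≤ v + 1 + t) := Iff.rfl

theorem mem_add {N : ℕ} (K : Set (Fin N × Fin N)) (a b c p q : Fin N) :
    (p, q) ∈ K ∪ {(a, b), (c, a)} ↔ (p, q) ∈ K ∨ (p.val = a.val ∧ q.val = b.val) ∨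
      (p.val = c.val ∧ q.val = a.val) := by
  simp only [Set.mem_union, Set.mem_insert_iff, Set.mem_singleton_iff, Prod.mk.injEq, Fin.ext_iff]

theorem grow_inner {N m : ℕ} (hm : Odd m) (h3 : 3 ≤ m) (hN : m + 2 ≤ N) {P Q R : Fin N}
    (hP : P.val = m - 1) (hQ : Q.val = m) (hR : R.val = m + 1)
    {S : Equiv.Perm (Fin N) → Equiv.Perm (Fin N)} (hS : Ham N m S) (v : ℕ)
    (h0 : ∃ f, Good N m P Q R (KK N (m + 2) (v + 1)) f) (t : ℕ) (ht : v + 1 + t ≤ m + 1) :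
    ∃ f, Good N m P Q R (KI N (m + 2) v t) f := by
  induction t with
  | zero =>
    have : KI N (m + 2) v 0 = KK N (m + 2) (v + 1) := by
      ext ⟨p, q⟩
      rw [mem_KI, mem_KK]; omega
    rwa [this]
  | succ t ih =>
    obtain ⟨f, hf⟩ := ih (by omega)
    have := growth hm h3 hN hP hQ hR hS hf (a := ⟨v, by omega⟩) (b := ⟨v + 1 + t, by omega⟩)
      (c := ⟨v + 1 + t + 1, by omega⟩) (by rw [mem_KI]; simp only; omega)
      (by rw [Ne, Fin.ext_iff]; simp only; omega) (by rw [Ne, Fin.ext_iff]; simp only; omega)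
      (by simp only; omega) (by rw [mem_KI]; simp only; omega) (by rw [mem_KI]; simp only; omega)
    convert this using 3
    ext ⟨p, q⟩
    rw [mem_add, mem_KI, mem_KI]
    simp only
    omega

theorem grow_outer {N m : ℕ} (hm : Odd m) (h3 : 3 ≤ m) (hN : m + 2 ≤ N) {P Q R : Fin N}
    (hP : P.val = m - 1) (hQ : Q.val = m) (hR : R.val = m + 1)
    {S : Equiv.Perm (Fin N) → Equiv.Perm (Fin N)} (hS : Ham N m S) (j : ℕ) (hj : j ≤ m)
    (h0 : ∃ f, Good N m P Q R (KK N (m + 2) j) f) :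
    ∃ f, Good N m P Q R (KK N (m + 2) 0) f := by
  induction j with
  | zero => exact h0
  | succ v ih =>
    apply ih (by omega)
    obtain ⟨f, hf⟩ := grow_inner hm h3 hN hP hQ hR hS v h0 (m - v) (by omega)
    have := growth hm h3 hN hP hQ hR hS hf (a := ⟨v, by omega⟩) (b := ⟨m + 1, by omega⟩)
      (c := ⟨v + 1, by omega⟩) (by rw [mem_KI]; simp only; omega)
      (by rw [Ne, Fin.ext_iff]; simp only; omega) (by rw [Ne, Fin.ext_iff]; simp only; omega)
      (by simp only; omega) (by rw [mem_KI]; simp only; omega) (by rw [mem_KI]; simp only; omega)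
    convert this using 3
    ext ⟨p, q⟩
    rw [mem_add, mem_KI, mem_KK]
    simp only
    omega

theorem Ham_of_Good {N m : ℕ} (_ : 3 ≤ m) (_ : m + 2 ≤ N) {P Q R : Fin N}
    (hQ : Q.val = m) (hR : R.val = m + 1) {f : Equiv.Perm (Fin N) → Equiv.Perm (Fin N)}
    (hf : Good N m P Q R (KK N (m + 2) 0) f) : Ham N (m + 2) f := by
  have hX : XX N (m + 2) Q R (KK N (m + 2) 0) = (AA N (m + 2) : Set (Equiv.Perm (Fin N))) := by
    ext g
    constructor
    · exact fun h => h.1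
    · intro h
      refine ⟨h, ?_⟩
      rw [mem_KK]
      refine ⟨fun e => ?_, Nat.zero_le _, Nat.zero_le _, AA_lt h (by omega), AA_lt h (by omega)⟩
      have := congrArg Fin.val (g.injective (Fin.ext e))
      omega
  refine ⟨hX ▸ hf.sc, ?_, ?_, hf.trip⟩
  · intro g hg
    exact hf.edge g (by rw [hX]; exact hg)
  · intro v P' hv hP'
    have hP'R : P' = R := Fin.ext (by omega)
    have : ∃ p : Fin N, (p, v) ∈ KK N (m + 2) 0 := by
      by_cases h0 : v.val = 0
      · exact ⟨⟨1, by omega⟩, by rw [mem_KK]; simp only; omega⟩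
      · exact ⟨⟨0, by omega⟩, by rw [mem_KK]; simp only; omega⟩
    obtain ⟨p, hp⟩ := this
    obtain ⟨g, hg, h1, h2⟩ := hf.last p v hp
    exact ⟨g, hg.1, hP'R ▸ h1, h2⟩

/-- Run a word (base 4 digits of `w`) for `t` steps from the state `s`. -/
def runS (st : ℕ → ℕ → ℕ) (t : ℕ) : ℕ → ℕ → ℕ :=
  Nat.rec (motive := fun _ => ℕ → ℕ → ℕ) (fun s _ => s)
    (fun _ r s w => r (st (w % 4) s) (w / 4)) t

/-- Check that the states of a run have distinct codes. -/
def chk (st : ℕ → ℕ → ℕ) (t : ℕ) : ℕ → ℕ → ℕ → Bool :=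
  Nat.rec (motive := fun _ => ℕ → ℕ → ℕ → Bool) (fun _ _ _ => true)
    (fun _ r s w mask => bif Nat.beq ((mask >>> (s % 32768)) % 2) 0 then
      r (st (w % 4) s) (w / 4) (mask ||| (1 <<< (s % 32768))) else false) t

theorem runS_succ (st : ℕ → ℕ → ℕ) (t s w : ℕ) :
    runS st (t + 1) s w = runS st t (st (w % 4) s) (w / 4) := rfl

theorem runS_snoc (st : ℕ → ℕ → ℕ) (t s w : ℕ) :
    runS st (t + 1) s w = st (w / 4 ^ t % 4) (runS st t s w) := by
  induction t generalizing s w with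
  | zero => simp [runS]
  | succ t ih =>
    rw [runS_succ, ih, runS_succ, Nat.div_div_eq_div_mul, pow_succ']

theorem chk_succ (st : ℕ → ℕ → ℕ) (t s w mask : ℕ) :
    chk st (t + 1) s w mask = bif Nat.beq ((mask >>> (s % 32768)) % 2) 0 then
      chk st t (st (w % 4) s) (w / 4) (mask ||| (1 <<< (s % 32768))) else false := rfl

theorem chk_sound (st : ℕ → ℕ → ℕ) (t s w mask : ℕ) (h : chk st t s w mask = true) :
    (∀ i < t, mask.testBit (runS st i s w % 32768) = false) ∧
    ∀ i j, i < j → j < t → runS st i s w % 32768 ≠ runS st j s w % 32768 := by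
  induction t generalizing s w mask with
  | zero => exact ⟨fun i hi => absurd hi (by omega), fun i j _ hj => absurd hj (by omega)⟩
  | succ t ih =>
    rw [chk_succ] at h
    cases hb : Nat.beq ((mask >>> (s % 32768)) % 2) 0 with
    | false => rw [hb] at h; simp at h
    | true =>
      rw [hb, cond_true] at h
      obtain ⟨h1, h2⟩ := ih _ _ _ h
      have h0 : mask.testBit (s % 32768) = false := by
        have := Nat.eq_of_beq_eq_true hb
        rw [Nat.testBit_eq_decide_div_mod_eq, ← Nat.shiftRight_eq_div_pow, this]; rfl
      refine ⟨fun i hi => ?_, fun i j hij hj => ?_⟩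
      · cases i with
        | zero => exact h0
        | succ i =>
          have := h1 i (by omega)
          rw [Nat.testBit_or, Bool.or_eq_false_iff] at this
          exact this.1
      · cases j with
        | zero => omega
        | succ j =>
          cases i with
          | zero =>
            have := h1 j (by omega)
            rw [Nat.testBit_or, Bool.or_eq_false_iff] at this
            intro heq
            rw [runS_succ, ] at heq
            have h3 := this.2
            rw [← heq] at h3
            simp [runS, Nat.testBit_shiftLeft] at h3
          | succ i => exact h2 i j (by omega) (by omega)

/-- The path of permutations spelled by the word `W`. -/
def pth {l : ℕ} (gen : ℕ → Equiv.Perm (Fin l)) (W : ℕ) : ℕ → Equiv.Perm (Fin l)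
  | 0 => 1
  | i + 1 => pth gen W i * gen (W / 4 ^ i % 4)

theorem pth_enc {l : ℕ} (gen : ℕ → Equiv.Perm (Fin l)) (W : ℕ) (enc : Equiv.Perm (Fin l) → ℕ)
    (st : ℕ → ℕ → ℕ) (h : ∀ k g, enc (g * gen k) = st k (enc g)) (i : ℕ) :
    enc (pth gen W i) = runS st i (enc 1) W := by
  induction i with
  | zero => rfl
  | succ i ih => rw [runS_snoc, pth, h, ih]

theorem pth_inj {l : ℕ} (gen : ℕ → Equiv.Perm (Fin l)) (W : ℕ) (enc : Equiv.Perm (Fin l) → ℕ)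
    (st : ℕ → ℕ → ℕ) (h : ∀ k g, enc (g * gen k) = st k (enc g)) (L : ℕ)
    (hc : chk st L (enc 1) W 0 = true) : ∀ i < L, ∀ j < L, pth gen W i = pth gen W j → i = j := by
  obtain ⟨-, h2⟩ := chk_sound _ _ _ _ _ hc
  intro i hi j hj hij
  have e : runS st i (enc 1) W = runS st j (enc 1) W := by
    rw [← pth_enc gen W enc st h, ← pth_enc gen W enc st h, hij]
  rcases Nat.lt_trichotomy i j with h' | h' | h'
  · exact absurd (by rw [e]) (h2 i j h' hj)
  · exact h'
  · exact absurd (by rw [e]) (h2 j i h' hi)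

/-- If the path has as many vertices as the alternating group, it covers it. -/
theorem pth_cover {l : ℕ} [Nontrivial (Fin l)] (gen : ℕ → Equiv.Perm (Fin l)) (W L : ℕ)
    (hsign : ∀ k, Equiv.Perm.sign (gen k) = 1)
    (hinj : ∀ i < L, ∀ j < L, pth gen W i = pth gen W j → i = j)
    (hL : 2 * L = Nat.factorial l) (g : Equiv.Perm (Fin l)) :
    Equiv.Perm.sign g = 1 ↔ ∃ i < L, pth gen W i = g := by
  have hs : ∀ i, Equiv.Perm.sign (pth gen W i) = 1 := by
    intro i
    induction i with
    | zero => simp [pth]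
    | succ i ih => rw [pth, Equiv.Perm.sign_mul, ih, hsign, one_mul]
  constructor
  · intro hg
    let F : Fin L → alternatingGroup (Fin l) := fun i => ⟨pth gen W i, hs i⟩
    have hF : Function.Injective F := fun i j hij =>
      Fin.ext (hinj i i.2 j j.2 (congrArg Subtype.val hij))
    have hcard : Fintype.card (Fin L) = Fintype.card (alternatingGroup (Fin l)) := by
      have := two_mul_card_alternatingGroup (α := Fin l)
      rw [Fintype.card_perm, Fintype.card_fin] at this
      rw [Fintype.card_fin]; omega
    obtain ⟨i, hi⟩ := ((Fintype.bijective_iff_injective_and_card F).2 ⟨hF, hcard⟩).2 ⟨g, hg⟩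
    exact ⟨i, i.2, congrArg Subtype.val hi⟩
  · rintro ⟨i, -, rfl⟩
    exact hs i

def st7 (k s : ℕ) : ℕ :=
  bif Nat.beq k 0 then s / 512 * 512 + s % 64 * 8 + s / 64 % 8
  else bif Nat.beq k 1 then s / 32768 * 32768 + s % 4096 * 8 + s / 4096 % 8
  else s % 262144 * 8 + s / 262144 % 8

def st5 (k s : ℕ) : ℕ :=
  bif Nat.beq k 0 then s / 512 * 512 + s % 64 * 8 + s / 64 % 8
  else bif Nat.beq k 1 then s / 512 * 512 + s % 8 * 64 + s / 8 % 64
  else s / 8 % 8 + s / 4096 % 8 * 8 + s % 8 * 64 + s / 64 % 64 * 512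

def W5 : ℕ := 553439268264178712262466944644061578

def W7 : ℕ :=
  3199220003665262892507891133843057421898883939542538272223365486045879259496372690566406471552666421372019279459686152732995622704414941424350500236442670777138438965994007157229155263964444387449388716826510630510706571511541570294336815371691437319188356069885302549661710030321228604461829675620002444721612290023259801385470417238556395028783044810254761920587029860822060797190837726065336873164290909827162160920680839261278137482572249768334297096419177816316087086809164141273924189522106832676114502533433272312321958876086863029085793694587029127219503702556435473525683238526876426952914662479540042049581682954372916002621821382973325625300710012671566494810109237717528485616441231831302141063720620279475954699324749207192241633944937611528235058776943081124887121515378190234901063791486265376047411764214917714048777131993141883146725251337980424733796501600892637025650875636802112634547607360177742566494850594282126454497001385077662054243138738339482039101901402085295775331876107017091380278069432812177940587665793323609284335894521513704914868850695799898382882101788639424686933705244582516465707361096576579710187194205185029885457048915753222169145263171258923204612747657561598591238871420793744962948134865438265713725570134936829859798190972273748101619014835686697884704803602840804542070342339157746523259572267505026362775677927297263193939640135915976617587954180405286416733067315778880820376442677414760755367913598561166692682082932121148573041421816491462438329912412199925127430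

theorem chk5 : chk st5 60 18056 W5 0 = true := by decide +kernel
theorem chk7 : chk st7 2520 1754760 W7 0 = true := by decide +kernel
theorem run7 : runS st7 2520 1754760 W7 = 1754760 := by decide +kernel

/-- Position `i` of the window starting at `a`. -/
def wp {N a l : ℕ} (h : a + l ≤ N) (i : Fin l) : Fin N := ⟨a + i.val, by omega⟩

/-- The window as a subtype. -/
def wnd {N a l : ℕ} (h : a + l ≤ N) : Fin l ≃ {i : Fin N // a ≤ i.val ∧ i.val < a + l} where
  toFun i := ⟨wp h i, by simp only [wp]; omega⟩
  invFun i := ⟨i.1.val - a, by have := i.2; omega⟩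
  left_inv i := by apply Fin.ext; simp [wp]
  right_inv i := by
    have := i.2
    apply Subtype.ext; apply Fin.ext; simp only [wp]; omega

/-- The embedding of permutations of a window. -/
def emb {N a l : ℕ} (h : a + l ≤ N) : Equiv.Perm (Fin l) →* Equiv.Perm (Fin N) :=
  Equiv.Perm.extendDomainHom (wnd h)

theorem emb_apply {N a l : ℕ} (h : a + l ≤ N) (d : Equiv.Perm (Fin l)) (i : Fin l) :
    emb h d (wp h i) = wp h (d i) :=
  Equiv.Perm.extendDomain_apply_image d (wnd h) i

theorem emb_out {N a l : ℕ} (h : a + l ≤ N) (d : Equiv.Perm (Fin l)) (i : Fin N)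
    (hi : ¬ (a ≤ i.val ∧ i.val < a + l)) : emb h d i = i :=
  Equiv.Perm.extendDomain_apply_not_subtype d (wnd h) hi

theorem wp_inj {N a l : ℕ} (h : a + l ≤ N) {i j : Fin l} (hij : wp h i = wp h j) : i = j := by
  have := congrArg Fin.val hij
  simp only [wp] at this
  omega

theorem wp_surj {N a l : ℕ} (h : a + l ≤ N) (i : Fin N) (hi : a ≤ i.val ∧ i.val < a + l) :
    ∃ j, wp h j = i :=
  ⟨⟨i.val - a, by omega⟩, Fin.ext (by simp only [wp]; omega)⟩

theorem emb_sign {N a l : ℕ} (h : a + l ≤ N) (d : Equiv.Perm (Fin l)) :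
    Equiv.Perm.sign (emb h d) = Equiv.Perm.sign d :=
  Equiv.Perm.sign_extendDomain d (wnd h)

theorem emb_inj {N a l : ℕ} (h : a + l ≤ N) : Function.Injective (emb h) :=
  Equiv.Perm.extendDomainHom_injective (wnd h)

theorem emb_ext {N a l : ℕ} (h : a + l ≤ N) (d : Equiv.Perm (Fin l)) (g : Equiv.Perm (Fin N))
    (h1 : ∀ i, g (wp h i) = wp h (d i))
    (h2 : ∀ i : Fin N, ¬ (a ≤ i.val ∧ i.val < a + l) → g i = i) : emb h d = g := by
  apply Equiv.ext
  intro i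
  by_cases hi : a ≤ i.val ∧ i.val < a + l
  · obtain ⟨j, rfl⟩ := wp_surj h i hi
    rw [emb_apply, h1]
  · rw [emb_out h d i hi, h2 i hi]

theorem emb_surj {N a l : ℕ} (h : a + l ≤ N) (g : Equiv.Perm (Fin N))
    (h2 : ∀ i : Fin N, ¬ (a ≤ i.val ∧ i.val < a + l) → g i = i) : ∃ d, emb h d = g := by
  have key : ∀ i, ∃ j, g (wp h i) = wp h j := by
    intro i
    by_cases hi : a ≤ (g (wp h i)).val ∧ (g (wp h i)).val < a + l
    · obtain ⟨j, hj⟩ := wp_surj h _ hi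
      exact ⟨j, hj.symm⟩
    · exact ⟨i, g.injective (h2 _ hi)⟩
  choose F hF using key
  have hinj : Function.Injective F := by
    intro i j hij
    apply wp_inj h
    apply g.injective
    rw [hF, hF, hij]
  exact ⟨Equiv.ofBijective F (Finite.injective_iff_bijective.1 hinj), emb_ext h _ _ hF h2⟩

theorem emb_mem {N a l : ℕ} (h : a + l ≤ N) {d : Equiv.Perm (Fin l)}
    (hd : Equiv.Perm.sign d = 1) : emb h d ∈ AA N (a + l) :=
  ⟨by rw [emb_sign, hd], fun i hi => emb_out h d i (by omega)⟩

theorem emb_xx {N a l n : ℕ} (h : a + l ≤ N) (h3 : 3 ≤ n) (hn : n ≤ l) :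
    emb h (xx l n) = xx N (a + n) := by
  obtain ⟨a1, a2, a3, a4⟩ := xx_apply (N := l) (n := n) h3 hn (P := ⟨n - 3, by omega⟩)
    (Q := ⟨n - 2, by omega⟩) (R := ⟨n - 1, by omega⟩) rfl rfl rfl
  obtain ⟨b1, b2, b3, b4⟩ := xx_apply (N := N) (n := a + n) (by omega) (by omega)
    (P := wp h ⟨n - 3, by omega⟩) (Q := wp h ⟨n - 2, by omega⟩) (R := wp h ⟨n - 1, by omega⟩)
    (by simp only [wp]; omega) (by simp only [wp]; omega) (by simp only [wp]; omega)
  refine emb_ext h _ _ (fun i => ?_) (fun i hi => ?_)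
  · by_cases hP : i = ⟨n - 3, by omega⟩
    · rw [hP, b1, a1]
    by_cases hQ : i = ⟨n - 2, by omega⟩
    · rw [hQ, b2, a2]
    by_cases hR : i = ⟨n - 1, by omega⟩
    · rw [hR, b3, a3]
    rw [a4 i hP hQ hR, b4]
    · exact fun e => hP (wp_inj h e)
    · exact fun e => hQ (wp_inj h e)
    · exact fun e => hR (wp_inj h e)
  · have : ∀ j, i ≠ wp h j := by
      rintro j rfl
      apply hi
      simp only [wp]; omega
    exact b4 i (this _) (this _) (this _)

theorem emb_tau {N l k : ℕ} (h : 0 + l ≤ N) (hk : 1 ≤ k) (hkl : k ≤ l) :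
    emb h (tau l k) = tau N k := by
  refine emb_ext h _ _ (fun i => ?_) (fun i hi => tau_big hk i (by omega))
  rcases Nat.lt_or_ge i.val k with h1 | h1
  · rcases Nat.eq_zero_or_pos i.val with h0 | h0
    · rw [tau_zero hk hkl i ⟨k - 1, by omega⟩ h0 rfl]
      exact tau_zero hk (by omega) _ _ (by simp only [wp]; omega) (by simp only [wp]; omega)
    · rw [tau_mid hkl i ⟨i.val - 1, by omega⟩ h0 h1 rfl]
      exact tau_mid (by omega) _ _ (by simp only [wp]; omega) (by simp only [wp]; omega)
        (by simp only [wp]; omega)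
  · rw [tau_big hk i h1]
    exact tau_big hk _ (by simp only [wp]; omega)

theorem beq_ne {a b : ℕ} (h : a ≠ b) : Nat.beq a b = false := by
  cases h' : Nat.beq a b with
  | false => rfl
  | true => exact absurd (Nat.eq_of_beq_eq_true h') h

/-- Codes of permutations. -/
def enc5 (g : Equiv.Perm (Fin 5)) : ℕ :=
  (g 0).val + 8 * (g 1).val + 64 * (g 2).val + 512 * (g 3).val + 4096 * (g 4).val

def enc7 (g : Equiv.Perm (Fin 7)) : ℕ :=
  (g 0).val + 8 * (g 1).val + 64 * (g 2).val + 512 * (g 3).val + 4096 * (g 4).val +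
    32768 * (g 5).val + 262144 * (g 6).val

theorem enc5_inj {g h : Equiv.Perm (Fin 5)} (e : enc5 g = enc5 h) : g = h := by
  unfold enc5 at e
  apply Equiv.ext
  intro i
  apply Fin.ext
  fin_cases i <;> simp only [Fin.zero_eta, Fin.mk_one, Fin.reduceFinMk] <;> omega

theorem enc7_inj {g h : Equiv.Perm (Fin 7)} (e : enc7 g = enc7 h) : g = h := by
  unfold enc7 at e
  apply Equiv.ext
  intro i
  apply Fin.ext
  fin_cases i <;> simp only [Fin.zero_eta, Fin.mk_one, Fin.reduceFinMk] <;> omega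

def gen7 (k : ℕ) : Equiv.Perm (Fin 7) :=
  if k = 0 then tau 7 3 else if k = 1 then tau 7 5 else tau 7 7

def gen5 (k : ℕ) : Equiv.Perm (Fin 5) :=
  if k = 0 then xx 5 3 else if k = 1 then (xx 5 3)⁻¹ else xx 5 5 * (xx 5 3)⁻¹

theorem gen7_enc (k : ℕ) (g : Equiv.Perm (Fin 7)) : enc7 (g * gen7 k) = st7 k (enc7 g) := by
  by_cases h0 : k = 0
  · subst h0
    have h : ∀ i : Fin 7, tau 7 3 i = ![2, 0, 1, 3, 4, 5, 6] i := by decide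
    simp only [enc7, gen7, st7, Equiv.Perm.mul_apply, h, if_true, Nat.beq_refl, cond_true]
    simp only [Matrix.cons_val]
    omega
  by_cases h1 : k = 1
  · subst h1
    have h : ∀ i : Fin 7, tau 7 5 i = ![4, 0, 1, 2, 3, 5, 6] i := by decide
    simp only [enc7, gen7, st7, Equiv.Perm.mul_apply, if_true, if_neg one_ne_zero, h,
      Nat.beq_refl, cond_true, show Nat.beq 1 0 = false from rfl, cond_false]
    simp only [Matrix.cons_val]
    omega
  · have h : ∀ i : Fin 7, tau 7 7 i = ![6, 0, 1, 2, 3, 4, 5] i := by decide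
    have b0 : Nat.beq k 0 = false := beq_ne h0
    have b1 : Nat.beq k 1 = false := beq_ne h1
    simp only [enc7, gen7, st7, Equiv.Perm.mul_apply, if_neg h0, if_neg h1, h, b0, b1, cond_false]
    simp only [Matrix.cons_val]
    omega

theorem gen5_enc (k : ℕ) (g : Equiv.Perm (Fin 5)) : enc5 (g * gen5 k) = st5 k (enc5 g) := by
  by_cases h0 : k = 0
  · subst h0
    have h : ∀ i : Fin 5, xx 5 3 i = ![2, 0, 1, 3, 4] i := by decide
    simp only [enc5, gen5, st5, Equiv.Perm.mul_apply, h, if_true, Nat.beq_refl, cond_true]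
    simp only [Matrix.cons_val]
    omega
  by_cases h1 : k = 1
  · subst h1
    have h : ∀ i : Fin 5, (xx 5 3)⁻¹ i = ![1, 2, 0, 3, 4] i := by decide
    simp only [enc5, gen5, st5, Equiv.Perm.mul_apply, if_true, if_neg one_ne_zero, h,
      Nat.beq_refl, cond_true, show Nat.beq 1 0 = false from rfl, cond_false]
    simp only [Matrix.cons_val]
    omega
  · have h : ∀ i : Fin 5, (xx 5 5 * (xx 5 3)⁻¹) i = ![1, 4, 0, 2, 3] i := by decide
    have b0 : Nat.beq k 0 = false := beq_ne h0
    have b1 : Nat.beq k 1 = false := beq_ne h1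
    have h' : ∀ i : Fin 5, (g * (xx 5 5 * (xx 5 3)⁻¹)) i = g (![1, 4, 0, 2, 3] i) := by
      intro i; rw [← h i]; rfl
    simp only [enc5, gen5, st5, if_neg h0, if_neg h1, b0, b1, cond_false, h']
    simp only [Matrix.cons_val]
    omega

theorem sign_xx {N n : ℕ} (hn : Odd n) (h3 : 3 ≤ n) : Equiv.Perm.sign (xx N n) = 1 :=
  (xx_mem hn h3).1

theorem gen7_sign (k : ℕ) : Equiv.Perm.sign (gen7 k) = 1 := by
  unfold gen7
  split_ifs <;> exact sign_tau (by decide)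

theorem gen5_sign (k : ℕ) : Equiv.Perm.sign (gen5 k) = 1 := by
  have h1 : Equiv.Perm.sign (xx 5 3) = 1 := sign_xx (by decide) (by decide)
  have h2 : Equiv.Perm.sign (xx 5 5) = 1 := sign_xx (by decide) (by decide)
  unfold gen5
  split_ifs <;> simp only [Equiv.Perm.sign_mul, Equiv.Perm.sign_inv, h1, h2, mul_one]

theorem triple_path {α : Type*} (p : ℕ → α) (L : ℕ) (f : α → α)
    (hf : ∀ i < L, f (p i) = p (i + 1)) (hinj : ∀ i < L, ∀ j < L, p i = p j → i = j)
    (b c : ℕ) (hb : 0 < b) (hbc : b < c) (hc : c < L) (E : Set α)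
    (hE : ∀ e ∈ E, e = p 0 ∨ e = p b ∨ e = p c) :
    Rch f E (f (p 0)) (p b) ∧ Rch f E (f (p b)) (p c) ∧ Rch f E (f (p c)) (p L) := by
  have key : ∀ i j, i < j → j ≤ L → (∀ t, i < t → t < j → t ≠ 0 ∧ t ≠ b ∧ t ≠ c) →
      Rch f E (f (p i)) (p j) := by
    intro i j hij hj h
    rw [hf i (by omega)]
    refine path_cycle p L f hf E (i + 1) j hij hj (fun t h1 h2 ht => ?_)
    obtain ⟨h3, h4, h5⟩ := h t (by omega) h2
    rcases hE _ ht with e | e | e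
    · exact h3 (hinj t (by omega) 0 (by omega) e)
    · exact h4 (hinj t (by omega) b (by omega) e)
    · exact h5 (hinj t (by omega) c (by omega) e)
  exact ⟨key _ _ (by omega) (by omega) (fun t _ _ => by omega),
    key _ _ (by omega) (by omega) (fun t _ _ => by omega),
    key _ _ (by omega) (by omega) (fun t _ _ => by omega)⟩

theorem path_fun {α : Type*} (p : ℕ → α) (L : ℕ) (hinj : ∀ i < L, ∀ j < L, p i = p j → i = j) :
    ∃ f : α → α, ∀ i < L, f (p i) = p (i + 1) := by
  classical
  refine ⟨fun a => if h : ∃ i < L, p i = a then p (h.choose + 1) else a, fun i hi => ?_⟩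
  have h : ∃ i' < L, p i' = p i := ⟨i, hi, rfl⟩
  simp only [dif_pos h]
  rw [hinj _ h.choose_spec.1 i hi h.choose_spec.2]

theorem enc7_one : enc7 1 = 1754760 := by decide

theorem enc7_pth (i : ℕ) : enc7 (pth gen7 W7 i) = runS st7 i 1754760 W7 := by
  rw [pth_enc gen7 W7 enc7 st7 gen7_enc, enc7_one]

theorem inj7 : ∀ i < 2520, ∀ j < 2520, pth gen7 W7 i = pth gen7 W7 j → i = j :=
  pth_inj gen7 W7 enc7 st7 gen7_enc 2520 (by rw [enc7_one]; exact chk7)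

theorem cover7 (g : Equiv.Perm (Fin 7)) :
    Equiv.Perm.sign g = 1 ↔ ∃ i < 2520, pth gen7 W7 i = g :=
  pth_cover gen7 W7 2520 gen7_sign inj7 (by decide) g

theorem pth7_L : pth gen7 W7 2520 = 1 := enc7_inj (by rw [enc7_pth, enc7_one, run7])

theorem pth7_b : pth gen7 W7 125 = (xx 7 7)⁻¹ := by
  apply enc7_inj
  rw [enc7_pth]
  decide +kernel

theorem pth7_c : pth gen7 W7 2491 = xx 7 7 := by
  apply enc7_inj
  rw [enc7_pth]
  decide +kernel

theorem last7 : ∀ v : Fin 7, ∃ i < 2520, pth gen7 W7 i 6 = v ∧ W7 / 4 ^ i % 4 = 2 := by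
  intro v
  have key : ∀ i, runS st7 i 1754760 W7 / 262144 = v.val → pth gen7 W7 i 6 = v := by
    intro i h
    rw [← enc7_pth] at h
    unfold enc7 at h
    apply Fin.ext
    omega
  fin_cases v
  · exact ⟨44, by decide, key 44 (by decide +kernel), by decide +kernel⟩
  · exact ⟨11, by decide, key 11 (by decide +kernel), by decide +kernel⟩
  · exact ⟨36, by decide, key 36 (by decide +kernel), by decide +kernel⟩
  · exact ⟨28, by decide, key 28 (by decide +kernel), by decide +kernel⟩
  · exact ⟨9, by decide, key 9 (by decide +kernel), by decide +kernel⟩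
  · exact ⟨5, by decide, key 5 (by decide +kernel), by decide +kernel⟩
  · exact ⟨0, by decide, key 0 (by decide +kernel), by decide +kernel⟩

theorem kind7 : W7 / 4 ^ 0 % 4 = 2 ∧ W7 / 4 ^ 125 % 4 = 2 ∧ W7 / 4 ^ 2491 % 4 = 2 := by
  decide +kernel

theorem Ham_base {N : ℕ} (hN : 7 ≤ N) : ∃ f, Ham N 7 f := by
  have h : 0 + 7 ≤ N := by omega
  set p : ℕ → Equiv.Perm (Fin N) := fun i => emb h (pth gen7 W7 i) with hp
  have hinj : ∀ i < 2520, ∀ j < 2520, p i = p j → i = j := fun i hi j hj e =>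
    inj7 i hi j hj (emb_inj h e)
  obtain ⟨f, hf⟩ := path_fun p 2520 hinj
  have t3 : emb h (tau 7 3) = tau N 3 := emb_tau h (by omega) (by omega)
  have t5 : emb h (tau 7 5) = tau N 5 := emb_tau h (by omega) (by omega)
  have t7 : emb h (tau 7 7) = tau N 7 := emb_tau h (by omega) (by omega)
  have hx : emb h (xx 7 7) = xx N 7 := by
    have := emb_xx h (n := 7) (by omega) le_rfl
    rwa [Nat.zero_add] at this
  have hstep : ∀ i < 2520, f (p i) = p i * emb h (gen7 (W7 / 4 ^ i % 4)) := by
    intro i hi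
    rw [hf i hi, hp]
    simp only [pth, map_mul]
  have hstep7 : ∀ i < 2520, W7 / 4 ^ i % 4 = 2 → f (p i) = p i * tau N 7 := by
    intro i hi hk
    rw [hstep i hi, hk, ← t7]
    rfl
  have hcov : ∀ g, g ∈ AA N 7 ↔ ∃ i < 2520, p i = g := by
    intro g
    constructor
    · intro hg
      obtain ⟨d, rfl⟩ := emb_surj h g (fun i hi => hg.2 i (by omega))
      have hd := hg.1
      rw [emb_sign] at hd
      obtain ⟨i, hi, rfl⟩ := (cover7 d).1 hd
      exact ⟨i, hi, rfl⟩
    · rintro ⟨i, hi, rfl⟩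
      exact emb_mem h ((cover7 _).2 ⟨i, hi, rfl⟩)
  have p0 : p 0 = 1 := map_one _
  have pL : p 2520 = 1 := by simp only [hp, pth7_L, map_one]
  have pb : p 125 = (xx N 7)⁻¹ := by simp only [hp, pth7_b, map_inv, hx]
  have pc : p 2491 = xx N 7 := by simp only [hp, pth7_c, hx]
  have hcube := xx_cube (N := N) (n := 7) (by omega) hN
  have hsq : xx N 7 * xx N 7 = (xx N 7)⁻¹ := by
    rw [eq_inv_iff_mul_eq_one]; exact hcube
  obtain ⟨r1, r2, r3⟩ := triple_path p 2520 f hf hinj 125 2491 (by omega) (by omega) (by omega)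
    (EE N 7) (by
      rintro e (he | he | he)
      · left; rw [he, p0]
      · right; right; rw [he, pc]
      · right; left; rw [he, pb, hsq])
  refine ⟨f, ⟨?_, ?_, ?_, ?_⟩⟩
  · exact path_SC p 2520 (by omega) (by rw [pL, p0]) f hf _ hcov (path_cycle p 2520 f hf)
  · intro g hg
    obtain ⟨i, hi, rfl⟩ := (hcov g).1 hg
    rw [hstep i hi]
    unfold gen7
    split_ifs
    · exact ⟨3, by decide, by omega, by omega, by rw [t3]⟩
    · exact ⟨5, by decide, by omega, by omega, by rw [t5]⟩
    · exact ⟨7, by decide, by omega, by omega, by rw [t7]⟩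
  · intro v P hv hP
    obtain ⟨i, hi, h1, h2⟩ := last7 ⟨v.val, hv⟩
    refine ⟨p i, (hcov _).2 ⟨i, hi, rfl⟩, ?_, hstep7 i hi h2⟩
    have e : P = wp h 6 := Fin.ext (by rw [hP]; rfl)
    rw [e, hp]
    simp only
    rw [emb_apply, h1]
    exact Fin.ext (by simp [wp])
  · rintro e (he | he | he)
    · rw [he, one_mul, one_mul, ← pb, ← p0]
      refine ⟨?_, r1⟩
      rw [hstep7 0 (by omega) kind7.1, p0, one_mul]
    · rw [he, mul_inv_cancel, ← pL, ← pc]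
      exact ⟨hstep7 _ (by omega) kind7.2.2, r3⟩
    · have : xx N 7 * xx N 7 * (xx N 7)⁻¹ = p 2491 := by rw [mul_inv_cancel_right, pc]
      rw [he, this, hsq, ← pb]
      exact ⟨hstep7 _ (by omega) kind7.2.1, r2⟩

theorem enc5_one : enc5 1 = 18056 := by decide

theorem enc5_pth (i : ℕ) : enc5 (pth gen5 W5 i) = runS st5 i 18056 W5 := by
  rw [pth_enc gen5 W5 enc5 st5 gen5_enc, enc5_one]

theorem inj5 : ∀ i < 60, ∀ j < 60, pth gen5 W5 i = pth gen5 W5 j → i = j :=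
  pth_inj gen5 W5 enc5 st5 gen5_enc 60 (by rw [enc5_one]; exact chk5)

theorem cover5 (g : Equiv.Perm (Fin 5)) :
    Equiv.Perm.sign g = 1 ↔ ∃ i < 60, pth gen5 W5 i = g :=
  pth_cover gen5 W5 60 gen5_sign inj5 (by decide) g

theorem pth5_L : pth gen5 W5 60 = 1 := by
  apply enc5_inj
  rw [enc5_pth]
  decide +kernel

theorem pth5_b : pth gen5 W5 18 = (xx 5 5)⁻¹ := by
  apply enc5_inj
  rw [enc5_pth]
  decide +kernel

theorem pth5_c : pth gen5 W5 37 = xx 5 5 := by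
  apply enc5_inj
  rw [enc5_pth]
  decide +kernel

theorem kind5 : W5 / 4 ^ 0 % 4 = 2 ∧ W5 / 4 ^ 18 % 4 = 2 ∧ W5 / 4 ^ 37 % 4 = 2 := by
  decide +kernel

theorem last5 (v : Fin 5) : ∃ i < 60, pth gen5 W5 i 4 = v ∧ W5 / 4 ^ i % 4 = 2 := by
  have h : ∀ v : Fin 5, ∃ i : Fin 60, runS st5 i.val 18056 W5 / 4096 = v.val ∧
      W5 / 4 ^ i.val % 4 = 2 := by decide +kernel
  obtain ⟨i, h1, h2⟩ := h v
  refine ⟨i.val, i.2, ?_, h2⟩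
  rw [← enc5_pth] at h1
  unfold enc5 at h1
  apply Fin.ext
  omega

theorem rep5 (u v : Fin 5) (huv : u ≠ v) :
    ∃ d : Equiv.Perm (Fin 5), Equiv.Perm.sign d = 1 ∧ d 3 = u ∧ d 4 = v := by
  have h : ∀ u v : Fin 5, u ≠ v → ∃ i : Fin 60, runS st5 i.val 18056 W5 / 4096 = v.val ∧
      runS st5 i.val 18056 W5 / 512 % 8 = u.val := by decide +kernel
  obtain ⟨i, h1, h2⟩ := h u v huv
  refine ⟨pth gen5 W5 i.val, (cover5 _).2 ⟨i.val, i.2, rfl⟩, ?_, ?_⟩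
  · rw [← enc5_pth] at h2
    unfold enc5 at h2
    apply Fin.ext
    omega
  · rw [← enc5_pth] at h1
    unfold enc5 at h1
    apply Fin.ext
    omega

theorem fix5 (d : Equiv.Perm (Fin 5)) (hd : Equiv.Perm.sign d = 1) (h3 : d 3 = 3) (h4 : d 4 = 4) :
    d = 1 ∨ d = xx 5 3 ∨ d = xx 5 3 * xx 5 3 := by
  have h : ∀ i : Fin 60, runS st5 i.val 18056 W5 / 4096 = 4 →
      runS st5 i.val 18056 W5 / 512 % 8 = 3 → runS st5 i.val 18056 W5 = enc5 1 ∨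
      runS st5 i.val 18056 W5 = enc5 (xx 5 3) ∨
      runS st5 i.val 18056 W5 = enc5 (xx 5 3 * xx 5 3) := by decide +kernel
  obtain ⟨i, hi, rfl⟩ := (cover5 d).1 hd
  have := h ⟨i, hi⟩
  simp only [← enc5_pth] at this
  have e : enc5 (pth gen5 W5 i) = (pth gen5 W5 i 0).val + 8 * (pth gen5 W5 i 1).val +
    64 * (pth gen5 W5 i 2).val + 512 * 3 + 4096 * 4 := by
      unfold enc5; rw [h3, h4]; rfl
  rcases this (by omega) (by omega) with h | h | h
  · exact Or.inl (enc5_inj h)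
  · exact Or.inr (Or.inl (enc5_inj h))
  · exact Or.inr (Or.inr (enc5_inj h))

theorem kd5 : ∃ kd : Equiv.Perm (Fin 5) → ℕ, ∀ i < 60, kd (pth gen5 W5 i) = W5 / 4 ^ i % 4 := by
  classical
  refine ⟨fun a => if h : ∃ i < 60, pth gen5 W5 i = a then W5 / 4 ^ h.choose % 4 else 0,
    fun i hi => ?_⟩
  have h : ∃ i' < 60, pth gen5 W5 i' = pth gen5 W5 i := ⟨i, hi, rfl⟩
  simp only [dif_pos h]
  rw [inj5 _ h.choose_spec.1 i hi h.choose_spec.2]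

theorem gadget {N s : ℕ} (hs4 : Odd (s + 3)) (hs : 2 ≤ s) (h : s + 5 ≤ N) {P Q R : Fin N}
    (hP : P.val = s + 2) (hQ : Q.val = s + 3) (hR : R.val = s + 4)
    {S : Equiv.Perm (Fin N) → Equiv.Perm (Fin N)} (hS : Ham N (s + 3) S) :
    ∃ f, Good N (s + 3) P Q R (KK N (s + 3 + 2) s) f := by
  classical
  set I : Set (Equiv.Perm (Fin 5)) := {d | Equiv.Perm.sign d = 1} with hI
  have I1 : (1 : Equiv.Perm (Fin 5)) ∈ I := Equiv.Perm.sign_one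
  have Imul : ∀ {a b}, a ∈ I → b ∈ I → a * b ∈ I := by
    intro a b ha hb
    rw [hI, Set.mem_ofPred_eq] at *
    rw [Equiv.Perm.sign_mul, ha, hb, one_mul]
  have Iinv : ∀ {a}, a ∈ I → a⁻¹ ∈ I := by
    intro a ha
    rw [hI, Set.mem_ofPred_eq] at *
    rw [Equiv.Perm.sign_inv, ha]
  have Ix : xx 5 5 ∈ I := sign_xx (by decide) (by decide)
  have Iy : xx 5 3 ∈ I := sign_xx (by decide) (by decide)
  have Igen : ∀ k, gen5 k ∈ I := gen5_sign
  set K := KK N (s + 3 + 2) s with hK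
  set X := XX N (s + 3 + 2) Q R K with hX
  have eP : P = wp h 2 := Fin.ext (by rw [hP]; rfl)
  have eQ : Q = wp h 3 := Fin.ext (by rw [hQ]; rfl)
  have eR : R = wp h 4 := Fin.ext (by rw [hR]; rfl)
  have φy : emb h (xx 5 3) = xx N (s + 3) := emb_xx h (by omega) (by omega)
  have φx : emb h (xx 5 5) = xx N (s + 3 + 2) := emb_xx h (n := 5) (by omega) (by omega)
  have φA : ∀ d ∈ I, emb h d ∈ AA N (s + 3 + 2) := fun d hd => emb_mem h hd
  have φX : ∀ d ∈ I, emb h d ∈ X := by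
    intro d hd
    refine ⟨φA d hd, ?_⟩
    rw [hK, mem_KK, eQ, eR, emb_apply, emb_apply]
    refine ⟨fun e => ?_, ?_, ?_, ?_, ?_⟩
    · have := d.injective (wp_inj h (Fin.ext e))
      exact absurd this (by decide)
    all_goals (simp only [wp]; omega)
  -- representatives
  have hrep : ∀ p q : Fin N, ∃ d : Equiv.Perm (Fin 5), d ∈ I ∧
      ((p, q) ∈ K → emb h d Q = p ∧ emb h d R = q) := by
    intro p q
    by_cases hpq : (p, q) ∈ K
    · have h' := (mem_KK p q).1 hpq
      obtain ⟨u, rfl⟩ := wp_surj h p (by omega)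
      obtain ⟨v, rfl⟩ := wp_surj h q (by omega)
      obtain ⟨d, h1, h2, h3⟩ := rep5 u v (fun e => h'.1 (by rw [e]))
      exact ⟨d, h1, fun _ => by rw [eQ, eR, emb_apply, emb_apply, h2, h3]; exact ⟨rfl, rfl⟩⟩
    · exact ⟨1, I1, fun h => absurd h hpq⟩
  choose B BI BK using hrep
  set f0 : Equiv.Perm (Fin N) → Equiv.Perm (Fin N) :=
    fun g => emb h (B (g Q) (g R)) * S ((emb h (B (g Q) (g R)))⁻¹ * g) with hf0
  have uQ : ∀ u ∈ AA N (s + 3), u Q = Q := fun u hu => hu.2 Q (by omega)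
  have uR : ∀ u ∈ AA N (s + 3), u R = R := fun u hu => hu.2 R (by omega)
  have memX : ∀ p q, (p, q) ∈ K → ∀ u ∈ AA N (s + 3), emb h (B p q) * u ∈ X := by
    intro p q hpq u hu
    refine ⟨mul_mem (φA _ (BI p q)) (AA_mono (by omega) hu), ?_⟩
    rw [Equiv.Perm.mul_apply, Equiv.Perm.mul_apply, uQ u hu, uR u hu, (BK p q hpq).1,
      (BK p q hpq).2]
    exact hpq
  have K1 : ∀ p q, (p, q) ∈ K → ∀ u ∈ AA N (s + 3),
      f0 (emb h (B p q) * u) = emb h (B p q) * S u := by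
    intro p q hpq u hu
    rw [hf0]
    simp only [Equiv.Perm.mul_apply, uQ u hu, uR u hu, (BK p q hpq).1, (BK p q hpq).2,
      inv_mul_cancel_left]
  have inEE : ∀ d ∈ I, emb h d ∈ AA N (s + 3) → emb h d ∈ EE N (s + 3) := by
    intro d hd hA
    have h3 := uQ _ hA
    have h4 := uR _ hA
    rw [eQ, emb_apply] at h3
    rw [eR, emb_apply] at h4
    rcases fix5 d hd (wp_inj h h3) (wp_inj h h4) with rfl | rfl | rfl
    · left; exact map_one _
    · right; left; exact φy
    · right; right; rw [map_mul, φy]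
  have EEφ : ∀ e ∈ EE N (s + 3), ∃ d ∈ I, emb h d = e := by
    rintro e (rfl | rfl | rfl)
    · exact ⟨1, I1, map_one _⟩
    · exact ⟨_, Iy, φy⟩
    · exact ⟨_, Imul Iy Iy, by rw [map_mul, φy]⟩
  have K2 : ∀ p q, (p, q) ∈ K → ∀ u ∈ AA N (s + 3), ∀ v, Rch S (EE N (s + 3)) u v →
      Rch f0 (emb h '' I) (emb h (B p q) * u) (emb h (B p q) * v) := by
    intro p q hpq u hu v huv
    refine Rch.map (fun w => emb h (B p q) * w) (AA N (s + 3) : Set _) hS.sc.1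
      (fun w hw hwE => ⟨?_, K1 p q hpq w hw⟩) huv hu
    rintro ⟨d, hd, hdw⟩
    apply hwE
    have : w = emb h ((B p q)⁻¹ * d) := by
      rw [map_mul, map_inv, hdw, inv_mul_cancel_left]
    rw [this]
    apply inEE _ (Imul (Iinv (BI p q)) hd)
    rw [← this]; exact hw
  have split : ∀ g ∈ X, ∃ p q, (p, q) ∈ K ∧ ∃ u ∈ AA N (s + 3), g = emb h (B p q) * u := by
    intro g hg
    refine ⟨g Q, g R, hg.2, (emb h (B (g Q) (g R)))⁻¹ * g, ?_, by rw [mul_inv_cancel_left]⟩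
    rw [coset_iff (by omega) hQ (by omega) (φA _ (BI _ _))]
    exact ⟨hg.1, (BK _ _ hg.2).1.symm, (BK _ _ hg.2).2.symm⟩
  have splitφ : ∀ d ∈ I, ∃ p q, (p, q) ∈ K ∧ ∃ e ∈ EE N (s + 3), e ∈ AA N (s + 3) ∧
      emb h d = emb h (B p q) * e := by
    intro d hd
    obtain ⟨p, q, hpq, u, hu, e⟩ := split _ (φX d hd)
    refine ⟨p, q, hpq, u, ?_, hu, e⟩
    have : u = emb h ((B p q)⁻¹ * d) := by
      rw [map_mul, map_inv, e, inv_mul_cancel_left]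
    rw [this]
    apply inEE _ (Imul (Iinv (BI p q)) hd)
    rw [← this]; exact hu
  have f0φ : ∀ d ∈ I, f0 (emb h d) = emb h d * tau N (s + 3) := by
    intro d hd
    obtain ⟨p, q, hpq, e, he, heA, heq⟩ := splitφ d hd
    rw [heq, K1 p q hpq e heA, (hS.trip e he).1, mul_assoc]
  have f0X : ∀ g ∈ X, f0 g ∈ X := by
    intro g hg
    obtain ⟨p, q, hpq, u, hu, rfl⟩ := split g hg
    rw [K1 p q hpq u hu]
    exact memX p q hpq _ (hS.sc.1 u hu)
  -- the cycle
  obtain ⟨kd, hkd⟩ := kd5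
  set π : Equiv.Perm (Fin 5) → Equiv.Perm (Fin 5) := fun d => d * gen5 (kd d) * xx 5 3 with hπd
  set r : Equiv.Perm (Fin 5) → Equiv.Perm (Fin 5) := fun d => d * (xx 5 3)⁻¹ with hrd
  have hrπ : ∀ i < 60, (r ∘ π) (pth gen5 W5 i) = pth gen5 W5 (i + 1) := by
    intro i hi
    simp only [Function.comp, hπd, hrd, mul_inv_cancel_right, hkd i hi]
    rfl
  have πI : ∀ d ∈ I, π d ∈ I := fun d hd => Imul (Imul hd (Igen _)) Iy
  set f' : Equiv.Perm (Fin N) → Equiv.Perm (Fin N) := fun g =>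
    if hg : ∃ d ∈ I, emb h d = g then f0 (emb h (π hg.choose)) else f0 g with hf'
  have hoff : ∀ g, g ∉ emb h '' I → f' g = f0 g := fun g hg => dif_neg hg
  have hπ : ∀ d ∈ I, π d ∈ I ∧ f' (emb h d) = f0 (emb h (π d)) := by
    intro d hd
    refine ⟨πI d hd, ?_⟩
    have hg : ∃ d' ∈ I, emb h d' = emb h d := ⟨d, hd, rfl⟩
    rw [hf']
    simp only [dif_pos hg]
    rw [emb_inj h hg.choose_spec.2]
  have f'φ : ∀ d ∈ I, f' (emb h d) = emb h d * (emb h (gen5 (kd d) * xx 5 3) * tau N (s + 3)) := by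
    intro d hd
    rw [(hπ d hd).2, f0φ _ (πI d hd), hπd]
    simp only [map_mul, mul_assoc]
  have f'φ2 : ∀ d ∈ I, kd d = 2 → f' (emb h d) = emb h d * tau N (s + 3 + 2) := by
    intro d hd hk
    rw [f'φ d hd, hk, ← xx_mul_tau N (s + 3 + 2), ← φx]
    have : gen5 2 * xx 5 3 = xx 5 5 := by
      show xx 5 5 * (xx 5 3)⁻¹ * xx 5 3 = xx 5 5
      rw [inv_mul_cancel_right]
    rw [this]; rfl
  have hr : ∀ d ∈ I, r d ∈ I ∧ Rch f0 (emb h '' I) (f0 (emb h d)) (emb h (r d)) := by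
    intro d hd
    refine ⟨Imul hd (Iinv Iy), ?_⟩
    obtain ⟨p, q, hpq, e, he, heA, heq⟩ := splitφ d hd
    have := K2 p q hpq (S e) (hS.sc.1 e heA) _ (hS.trip e he).2
    rw [← mul_assoc, ← heq, ← K1 p q hpq e heA, ← heq, ← φy, ← map_inv, ← map_mul] at this
    exact this
  have hSC : SC (r ∘ π) I :=
    path_SC (pth gen5 W5) 60 (by omega) (by rw [pth5_L]; rfl) (r ∘ π) hrπ I cover5
      (path_cycle (pth gen5 W5) 60 (r ∘ π) hrπ)
  have hsurj : ∀ d ∈ I, ∃ d' ∈ I, π d' = d := by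
    intro d hd
    obtain ⟨i, hi, e⟩ := (cover5 _).1 (Imul hd (Iinv Iy))
    have : ∃ i' < 60, pth gen5 W5 (i' + 1) = d * (xx 5 3)⁻¹ := by
      rcases Nat.eq_zero_or_pos i with h0 | h0
      · subst h0
        exact ⟨59, by omega, by rw [pth5_L, ← e]; rfl⟩
      · exact ⟨i - 1, by omega, by rw [Nat.sub_add_cancel h0, e]⟩
    obtain ⟨i', hi', e'⟩ := this
    refine ⟨pth gen5 W5 i', (cover5 _).2 ⟨i', hi', rfl⟩, ?_⟩
    have := hrπ i' hi'
    rw [e'] at this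
    exact mul_right_cancel this
  have hsc : SC f' X := by
    refine SC_master (emb h) I π r X φX f0X hoff hπ hsurj hr (emb_inj h).injOn hSC.2 ?_ ?_
    · intro g hg
      obtain ⟨p, q, hpq, u, hu, rfl⟩ := split g hg
      obtain ⟨e, he, hre⟩ := first_hit (EE N (s + 3)) (hS.sc.2 u hu 1 (one_mem _)) (Or.inl rfl)
      obtain ⟨d, hd, rfl⟩ := EEφ e he
      refine ⟨B p q * d, Imul (BI p q) hd, ?_⟩
      rw [map_mul]
      exact K2 p q hpq u hu _ hre
    · intro g hg
      obtain ⟨p, q, hpq, u, hu, rfl⟩ := split g hg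
      obtain ⟨e, he, hre⟩ := last_leave (EE N (s + 3)) (d0 := 1)
        (hS.sc.2 _ (hS.sc.1 1 (one_mem _)) u hu) (Or.inl rfl)
      have heA := EE_sub hs4 (by omega) he
      obtain ⟨d, hd, rfl⟩ := EEφ e he
      refine ⟨B p q * d, Imul (BI p q) hd, ?_⟩
      rw [map_mul, K1 p q hpq _ heA]
      exact K2 p q hpq _ (hS.sc.1 _ heA) _ hre
  have EE2 : ∀ e ∈ EE N (s + 3 + 2), e = emb h (pth gen5 W5 0) ∨ e = emb h (pth gen5 W5 18) ∨
      e = emb h (pth gen5 W5 37) := by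
    rintro e (rfl | rfl | rfl)
    · left; exact (map_one _).symm
    · right; right; rw [pth5_c, φx]
    · right; left; rw [pth5_b, map_inv, φx, eq_inv_iff_mul_eq_one]
      exact xx_cube (by omega) (by omega)
  have pI : ∀ i < 60, pth gen5 W5 i ∈ I := fun i hi => (cover5 _).2 ⟨i, hi, rfl⟩
  refine ⟨f', ⟨hsc, ?_, ?_, ?_, ?_, ?_⟩⟩
  · intro g hg
    by_cases hgI : g ∈ emb h '' I
    · obtain ⟨d, hd, rfl⟩ := hgI
      rw [f'φ d hd]
      unfold gen5
      split_ifs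
      · refine ⟨s + 3 - 2, ?_, by omega, by omega, ?_⟩
        · obtain ⟨c, hc⟩ := hs4
          exact ⟨c - 1, by omega⟩
        · rw [← xx_inv_mul_tau N (s + 3), map_mul, φy]
          congr 2
          rw [eq_inv_iff_mul_eq_one]
          exact xx_cube (by omega) (by omega)
      · exact ⟨s + 3, hs4, by omega, by omega, by rw [inv_mul_cancel, map_one, one_mul]⟩
      · refine ⟨s + 3 + 2, hs4.add_even (by decide), by omega, by omega, ?_⟩
        rw [inv_mul_cancel_right, φx]
        congr 1
        exact xx_mul_tau N (s + 3 + 2)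
    · rw [hoff g hgI]
      obtain ⟨p, q, hpq, u, hu, rfl⟩ := split g hg
      obtain ⟨k, h1, h2, h3, h4⟩ := hS.edge u hu
      exact ⟨k, h1, h2, by omega, by rw [K1 p q hpq u hu, h4, mul_assoc]⟩
  · intro a b c hbc hab hac ha hn1 hn2
    have hw : a.val < s := by
      rw [hK, mem_KK] at hbc hn1 hn2
      have : a.val ≠ b.val := fun e => hab (Fin.ext e)
      have : a.val ≠ c.val := fun e => hac (Fin.ext e)
      omega
    obtain ⟨u, hu, h1, h2⟩ := hS.last a P (by omega) (by omega)
    have hgP : (emb h (B b c) * u) P = a := by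
      rw [Equiv.Perm.mul_apply, h1, emb_out h _ a (by omega)]
    refine ⟨emb h (B b c) * u, memX b c hbc u hu, hgP, ?_, ?_, ?_⟩
    · rw [Equiv.Perm.mul_apply, uQ u hu, (BK b c hbc).1]
    · rw [Equiv.Perm.mul_apply, uR u hu, (BK b c hbc).2]
    · rw [hoff, K1 b c hbc u hu, h2, mul_assoc]
      rintro ⟨d, hd, e⟩
      rw [← e, eP, emb_apply] at hgP
      rw [← hgP] at hw
      simp only [wp] at hw
      omega
  · intro p q hpq
    have h' := (mem_KK p q).1 hpq
    obtain ⟨v, rfl⟩ := wp_surj h q (by omega)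
    obtain ⟨i, hi, h1, h2⟩ := last5 v
    refine ⟨emb h (pth gen5 W5 i), φX _ (pI i hi), ?_, f'φ2 _ (pI i hi) (by rw [hkd i hi, h2])⟩
    rw [eR, emb_apply, h1]
  · intro e he
    rcases EE2 e he with rfl | rfl | rfl
    · exact φX _ (pI _ (by omega))
    · exact φX _ (pI _ (by omega))
    · exact φX _ (pI _ (by omega))
  · set E : Set (Equiv.Perm (Fin 5)) :=
      {d | d = pth gen5 W5 0 ∨ d = pth gen5 W5 18 ∨ d = pth gen5 W5 37} with hE
    have hEI : E ⊆ I := by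
      rintro d (rfl | rfl | rfl)
      · exact pI _ (by omega)
      · exact pI _ (by omega)
      · exact pI _ (by omega)
    have hEE : EE N (s + 3 + 2) ⊆ emb h '' E := by
      intro e he
      rcases EE2 e he with rfl | rfl | rfl
      · exact ⟨_, Or.inl rfl, rfl⟩
      · exact ⟨_, Or.inr (Or.inl rfl), rfl⟩
      · exact ⟨_, Or.inr (Or.inr rfl), rfl⟩
    obtain ⟨r1, r2, r3⟩ := triple_path (pth gen5 W5) 60 (r ∘ π) hrπ inj5 18 37 (by omega)
      (by omega) (by omega) E (fun e he => he)
    have fin : ∀ i < 60, ∀ j, W5 / 4 ^ i % 4 = 2 →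
        Rch (r ∘ π) E ((r ∘ π) (pth gen5 W5 i)) (pth gen5 W5 j) →
        emb h (pth gen5 W5 j) = emb h (pth gen5 W5 i) * (xx N (s + 3 + 2))⁻¹ →
        f' (emb h (pth gen5 W5 i)) = emb h (pth gen5 W5 i) * tau N (s + 3 + 2) ∧
        Rch f' (EE N (s + 3 + 2)) (f' (emb h (pth gen5 W5 i)))
          (emb h (pth gen5 W5 i) * (xx N (s + 3 + 2))⁻¹) := by
      intro i hi j hk hrr hj
      refine ⟨f'φ2 _ (pI i hi) (by rw [hkd i hi, hk]), ?_⟩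
      rw [← hj]
      exact (ret_start (emb h) I π r hoff hπ hr E hEI (emb_inj h).injOn (pI i hi) hrr).anti hEE
    have hc5 : xx 5 5 = (xx 5 5)⁻¹ * (xx 5 5)⁻¹ := by
      rw [eq_mul_inv_iff_mul_eq, eq_inv_iff_mul_eq_one]
      exact xx_cube (by omega) (by omega)
    intro e he
    rcases EE2 e he with rfl | rfl | rfl
    · refine fin 0 (by omega) 18 kind5.1 r1 ?_
      rw [pth5_b, ← φx, ← map_inv, ← map_mul]
      congr 1
    · refine fin 18 (by omega) 37 kind5.2.1 r2 ?_
      rw [pth5_b, pth5_c, ← φx, ← map_inv, ← map_mul, ← hc5]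
    · refine fin 37 (by omega) 60 kind5.2.2 r3 ?_
      rw [pth5_L, pth5_c, ← φx, ← map_inv, ← map_mul, mul_inv_cancel]

theorem Ham_all {N : ℕ} (j : ℕ) (hj : 7 + 2 * j ≤ N) : ∃ f, Ham N (7 + 2 * j) f := by
  induction j with
  | zero => exact Ham_base hj
  | succ j ih =>
    obtain ⟨S, hS⟩ := ih (by omega)
    obtain ⟨s, hs⟩ : ∃ s, 7 + 2 * j = s + 3 := ⟨4 + 2 * j, by omega⟩
    have e : 7 + 2 * (j + 1) = s + 3 + 2 := by omega
    rw [e] at hj ⊢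
    rw [hs] at hS
    have hodd : Odd (s + 3) := ⟨j + 3, by omega⟩
    have h0 := gadget hodd (by omega) (by omega) (P := ⟨s + 2, by omega⟩) (Q := ⟨s + 3, by omega⟩)
      (R := ⟨s + 4, by omega⟩) rfl rfl rfl hS
    obtain ⟨f, hf⟩ := grow_outer hodd (by omega) hj (by simp only; omega) (by simp only)
      (by simp only) hS s (by omega) h0
    exact ⟨f, Ham_of_Good (by omega) hj (by simp only) (by simp only) hf⟩

/-- For odd `n ≥ 7`, the directed Cayley graph of `A_n` with generators
`τ_3, τ_5, …, τ_n` has a directed Hamiltonian cycle, encoded by a successor permutation `σ`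
of the vertex set `A_n` whose steps follow directed edges and which is a single cycle
through all of `A_n`. -/
theorem alternating_hamiltonian (n : ℕ) (hodd : Odd n) (h7 : 7 ≤ n) :
    ∃ σ : Equiv.Perm ↥(alternatingGroup (Fin n)),
      (∀ g : ↥(alternatingGroup (Fin n)),
        ∃ k, Odd k ∧ 3 ≤ k ∧ k ≤ n ∧ (↑(σ g) : Equiv.Perm (Fin n)) = ↑g * tau n k) ∧
      ∀ g h : ↥(alternatingGroup (Fin n)), ∃ m : ℕ, (σ ^ m) g = h := by
  obtain ⟨f, hf⟩ : ∃ f, Ham n n f := by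
    obtain ⟨c, hc⟩ := hodd
    have := Ham_all (N := n) (c - 3) (by omega)
    have e : 7 + 2 * (c - 3) = n := by omega
    rwa [e] at this
  have hA : ∀ g : Equiv.Perm (Fin n), g ∈ alternatingGroup (Fin n) ↔ g ∈ AA n n := by
    intro g
    rw [Equiv.Perm.mem_alternatingGroup, mem_AA]
    exact ⟨fun h => ⟨h, fun i hi => absurd i.2 (by omega)⟩, fun h => h.1⟩
  let F : alternatingGroup (Fin n) → alternatingGroup (Fin n) := fun g =>
    ⟨f g.1, (hA _).2 (hf.sc.1 _ ((hA _).1 g.2))⟩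
  have key : ∀ (g : alternatingGroup (Fin n)) (b : Equiv.Perm (Fin n)), Rch f ∅ g.1 b →
      ∃ m : ℕ, (F^[m] g).1 = b := by
    intro g b hb
    induction hb with
    | refl => exact ⟨0, rfl⟩
    | tail _ h2 ih =>
      obtain ⟨m, hm⟩ := ih
      refine ⟨m + 1, ?_⟩
      rw [Function.iterate_succ_apply', h2.2, ← hm]
  have key2 : ∀ g h : alternatingGroup (Fin n), ∃ m : ℕ, F^[m] g = h := by
    intro g h
    obtain ⟨m, hm⟩ := key g h.1 (hf.sc.2 _ ((hA _).1 g.2) _ ((hA _).1 h.2))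
    exact ⟨m, Subtype.ext hm⟩
  have hsurj : Function.Surjective F := by
    intro h
    obtain ⟨m, hm⟩ := key2 (F h) h
    rw [← Function.iterate_succ_apply, Function.iterate_succ_apply'] at hm
    exact ⟨_, hm⟩
  refine ⟨Equiv.ofBijective F (Finite.surjective_iff_bijective.1 hsurj), ?_, ?_⟩
  · intro g
    exact hf.edge g.1 ((hA _).1 g.2)
  · intro g h
    obtain ⟨m, hm⟩ := key2 g h
    refine ⟨m, ?_⟩
    rw [← hm, Equiv.Perm.coe_pow]
    rfl
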